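/- arXiv:0907.0044 — 2 statements merged into one kernel-verified Lean document; each statement's English description precedes it below -/
import Mathlib

section
/- Let λ be a k-bounded partition whose largest hook length satisfies λ_1 + ℓ(λ) − 1 ≤ k (so that 𝔠(λ) = λ). Then, for every k-bounded composition α, the map that replaces each letter of 𝒜_{α,x} by x (for every x) is a bijection from 𝒯^k_α(λ) onto the set of set-valued tableaux of shape λ and weight α; that is, the affine set-valued tableaux of shape λ are exactly the set-valued tableaux of shape λ. -/
open scoped Classical

namespace AffineKTheory

noncomputable instance : Nonempty YoungDiagram := ⟨⊥⟩

/-! ## Cells, hooks, cores, residues -/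

/-- Hook length of the cell `(r, c)` in the diagram `γ`. -/
def hookLen (γ : YoungDiagram) (r c : ℕ) : ℕ :=
  (γ.rowLen r - c) + (γ.colLen c - r) - 1

/-- A `p`-core: a diagram none of whose cells has hook length `p`. -/
def IsCore (p : ℕ) (γ : YoungDiagram) : Prop :=
  ∀ c : ℕ × ℕ, c ∈ γ → hookLen γ c.1 c.2 ≠ p

/-- The `(k+1)`-residue of a cell.  (Rows of the Ferrers shape are indexed so that the cell
directly above `(r, c)` -- in the Ferrers sense of the next, shorter, row -- is `(r+1, c)`.) -/
def residue (k : ℕ) (c : ℕ × ℕ) : ZMod (k + 1) :=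
  (c.2 : ZMod (k + 1)) - (c.1 : ZMod (k + 1))

/-- A removable corner of `γ`: a cell of `γ` with no cell above it nor to its right. -/
def Removable (γ : YoungDiagram) (c : ℕ × ℕ) : Prop :=
  c ∈ γ ∧ (c.1 + 1, c.2) ∉ γ ∧ (c.1, c.2 + 1) ∉ γ

/-- An addable corner of `γ`: a cell outside `γ` whose addition again yields a partition shape. -/
def Addable (γ : YoungDiagram) (c : ℕ × ℕ) : Prop :=
  c ∉ γ ∧ ∀ d : ℕ × ℕ, d ≤ c → d ≠ c → d ∈ γ

/-- A cell is `γ`-blocked if it lies below a cell of `γ`. -/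
def Blocked (γ : YoungDiagram) (c : ℕ × ℕ) : Prop :=
  (c.1 + 1, c.2) ∈ γ

/-- The number of cells of `γ` in row `i` whose hook length is at most `k`:
the `i`-th part of `𝔭(γ)`. -/
noncomputable def pRow (k : ℕ) (γ : YoungDiagram) (i : ℕ) : ℕ :=
  (γ.cells.filter (fun c => c.1 = i ∧ hookLen γ c.1 c.2 ≤ k)).card

/-- The number of cells of `γ` with `k`-bounded hook length, i.e. `|𝔭(γ)|`. -/
noncomputable def pSize (k : ℕ) (γ : YoungDiagram) : ℕ :=
  (γ.cells.filter (fun c => hookLen γ c.1 c.2 ≤ k)).card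

/-- A `k`-bounded partition: all parts at most `k`. -/
def IsKBounded (k : ℕ) (lam : YoungDiagram) : Prop :=
  ∀ i, lam.rowLen i ≤ k

/-- `𝔭(γ)`: the `k`-bounded partition obtained from a `(k+1)`-core `γ` by deleting every cell of
hook length greater than `k` and reading off row lengths. -/
noncomputable def pPart (k : ℕ) (γ : YoungDiagram) : YoungDiagram :=
  Classical.epsilon fun lam => ∀ i, lam.rowLen i = pRow k γ i

/-- `𝔠(λ)`: the unique `(k+1)`-core corresponding to the `k`-bounded partition `λ` under the
bijection `𝔭`. -/
noncomputable def coreOf (k : ℕ) (lam : YoungDiagram) : YoungDiagram :=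
  Classical.epsilon fun γ => IsCore (k + 1) γ ∧ ∀ i, pRow k γ i = lam.rowLen i

/-- The `k`-conjugate `λ^{ω_k} = 𝔭(𝔠(λ)')` of a `k`-bounded partition. -/
noncomputable def kConj (k : ℕ) (lam : YoungDiagram) : YoungDiagram :=
  pPart k ((coreOf k lam).transpose)

/-- A `k`-bounded composition: a list of parts, each between `1` and `k`. -/
def IsKBoundedComp (k : ℕ) (α : List ℕ) : Prop :=
  ∀ a ∈ α, 1 ≤ a ∧ a ≤ k

/-- Dominance order on partitions. -/
def Dominates (mu lam : YoungDiagram) : Prop :=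
  mu.card = lam.card ∧
    ∀ n : ℕ, ∑ i ∈ Finset.range n, lam.rowLen i ≤ ∑ i ∈ Finset.range n, mu.rowLen i


/-! ## Set-valued fillings and affine set-valued tableaux -/

/-- A set-valued filling of the shape `γ`: each cell of `γ` carries a finite nonempty set of
positive integers, empty outside `γ`, with `max X < min Y` when `X` is directly below `Y` and
`max X ≤ min Y` when `X` is directly to the left of `Y`. -/
def IsSVFilling (γ : YoungDiagram) (e : ℕ × ℕ → Finset ℕ) : Prop :=
  (∀ c : ℕ × ℕ, c ∈ γ ↔ (e c).Nonempty) ∧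
  (∀ c : ℕ × ℕ, ∀ x ∈ e c, 0 < x) ∧
  (∀ r c : ℕ, ∀ x ∈ e (r, c), ∀ y ∈ e (r + 1, c), x < y) ∧
  (∀ r c : ℕ, ∀ x ∈ e (r, c), ∀ y ∈ e (r, c + 1), x ≤ y)

/-- The set of cells of `T_{≤ x}`: cells containing a letter `≤ x`. -/
noncomputable def shapeLe (γ : YoungDiagram) (e : ℕ × ℕ → Finset ℕ) (x : ℕ) : Finset (ℕ × ℕ) :=
  γ.cells.filter fun c => ∃ y ∈ e c, y ≤ x

/-- A standard affine set-valued tableau of degree `n` and shape `γ`: a set-valued filling with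
letters `1, …, n` such that for each `x`, the shape of `T_{≤x}` is a `(k+1)`-core and the letter
`x` occupies exactly all of its removable corners of one single residue. -/
def IsStdASVT (k n : ℕ) (γ : YoungDiagram) (e : ℕ × ℕ → Finset ℕ) : Prop :=
  IsSVFilling γ e ∧
  (∀ c : ℕ × ℕ, ∀ y ∈ e c, y ≤ n) ∧
  ∀ x : ℕ, 1 ≤ x → x ≤ n →
    ∃ δ : YoungDiagram, IsCore (k + 1) δ ∧ δ.cells = shapeLe γ e x ∧
      ∃ i : ZMod (k + 1), (∃ c, x ∈ e c) ∧
        ∀ c : ℕ × ℕ, x ∈ e c ↔ Removable δ c ∧ residue k c = i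

/-- The alphabet `𝒜_{α,x} = {Σ^{x-1}α + 1, …, Σ^x α}`. -/
def alphaBlock (α : List ℕ) (x : ℕ) : Finset ℕ :=
  Finset.Ioc ((α.take (x - 1)).sum) ((α.take x).sum)

/-- `c` is the lowest occurrence of the letter `y`. -/
def IsLowestOcc (e : ℕ × ℕ → Finset ℕ) (y : ℕ) (c : ℕ × ℕ) : Prop :=
  y ∈ e c ∧ ∀ d : ℕ × ℕ, y ∈ e d → c.1 ≤ d.1

/-- `a` comes strictly before `b` in the reading order (top to bottom, left to right;
higher rows of the Ferrers shape have larger first coordinate here). -/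
def ReadBefore (a b : ℕ × ℕ) : Prop :=
  b.1 < a.1 ∨ (a.1 = b.1 ∧ a.2 < b.2)

/-- An affine set-valued tableau of weight `α` and shape `γ`: a standard affine set-valued
tableau of degree `|α|` such that for each `x`, the lowest reading word in `𝒜_{α,x}` is
increasing, the letters of `𝒜_{α,x}` occupy exactly `α_x` distinct residues, and they form a
horizontal strip. -/
def IsASVT (k : ℕ) (α : List ℕ) (γ : YoungDiagram) (e : ℕ × ℕ → Finset ℕ) : Prop :=
  IsStdASVT k α.sum γ e ∧
  ∀ x : ℕ, 1 ≤ x → x ≤ α.length →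
    (∀ y z : ℕ, y ∈ alphaBlock α x → z ∈ alphaBlock α x → y < z →
      ∀ cy cz : ℕ × ℕ, IsLowestOcc e y cy → IsLowestOcc e z cz → ReadBefore cy cz) ∧
    (((γ.cells.filter fun c => ∃ y ∈ alphaBlock α x, y ∈ e c).image (residue k)).card
        = α.getD (x - 1) 0) ∧
    (∀ c d : ℕ × ℕ, (∃ y ∈ alphaBlock α x, y ∈ e c) → (∃ y ∈ alphaBlock α x, y ∈ e d) →
      c.2 = d.2 → c = d)

/-- `𝒦^{(k)}_{λα}`: the number of affine set-valued tableaux of shape `𝔠(λ)` and weight `α`. -/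
noncomputable def Kcal (k : ℕ) (lam : YoungDiagram) (α : List ℕ) : ℕ :=
  Nat.card {e : ℕ × ℕ → Finset ℕ // IsASVT k α (coreOf k lam) e}

/-- A `k`-tableau of shape `γ` and weight `α`: a semistandard filling with letters `1,…,ℓ(α)`
(recorded as `0` outside `γ`) in which the letter `i` occupies exactly `α_i` distinct residues. -/
def IsKTab (k : ℕ) (α : List ℕ) (γ : YoungDiagram) (u : ℕ × ℕ → ℕ) : Prop :=
  (∀ c : ℕ × ℕ, c ∈ γ ↔ u c ≠ 0) ∧
  (∀ c : ℕ × ℕ, u c ≤ α.length) ∧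
  (∀ r c : ℕ, (r, c) ∈ γ → (r + 1, c) ∈ γ → u (r, c) < u (r + 1, c)) ∧
  (∀ r c : ℕ, (r, c) ∈ γ → (r, c + 1) ∈ γ → u (r, c) ≤ u (r, c + 1)) ∧
  ∀ i : ℕ, 1 ≤ i → i ≤ α.length →
    ((γ.cells.filter fun c => u c = i).image (residue k)).card = α.getD (i - 1) 0

/-- `K^{(k)}_{λα}`: the number of `k`-tableaux of shape `𝔠(λ)` and weight `α`. -/
noncomputable def Kktab (k : ℕ) (lam : YoungDiagram) (α : List ℕ) : ℕ :=
  Nat.card {u : ℕ × ℕ → ℕ // IsKTab k α (coreOf k lam) u}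

/-- A plain set-valued tableau of shape `λ` and weight `α`. -/
def IsSVT (α : List ℕ) (lam : YoungDiagram) (e : ℕ × ℕ → Finset ℕ) : Prop :=
  IsSVFilling lam e ∧ (∀ c : ℕ × ℕ, ∀ x ∈ e c, x ≤ α.length) ∧
  ∀ i : ℕ, 1 ≤ i → i ≤ α.length →
    (lam.cells.filter fun c => i ∈ e c).card = α.getD (i - 1) 0

/-- `𝒦_{λα}`: the number of set-valued tableaux of shape `λ` and weight `α`. -/
noncomputable def KcalSV (lam : YoungDiagram) (α : List ℕ) : ℕ :=
  Nat.card {e : ℕ × ℕ → Finset ℕ // IsSVT α lam e}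



/-! ## Coefficient series of affine Grothendieck polynomials and dual k-Schur functions -/

/-- The coefficient of `m_ν` in the affine Grothendieck polynomial
`G^{(k)}_λ = Σ_{μ ∈ 𝒫^k} (-1)^{|λ|+|μ|} 𝒦^{(k)}_{λμ} m_μ`
(a degree-wise finite formal series in the monomial symmetric functions). -/
noncomputable def Gcoeff (k : ℕ) (lam ν : YoungDiagram) : ℤ :=
  if IsKBounded k ν then (-1) ^ (lam.card + ν.card) * (Kcal k lam ν.rowLens : ℤ) else 0

/-- The coefficient of `m_ν` in the dual `k`-Schur function
`𝔖^{(k)}_λ = Σ_{μ ∈ 𝒫^k} K^{(k)}_{λμ} m_μ`. -/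
noncomputable def dualKSchurCoeff (k : ℕ) (lam ν : YoungDiagram) : ℤ :=
  if IsKBounded k ν then (Kktab k lam ν.rowLens : ℤ) else 0

/-- `blockOf α y = x` when `y ∈ 𝒜_{α,x}`: the map replacing each letter of `𝒜_{α,x}` by `x`. -/
noncomputable def blockOf (α : List ℕ) (y : ℕ) : ℕ :=
  sInf {x : ℕ | y ≤ (α.take x).sum}


/-! ## Small diagrams are their own cores -/

lemma hookLen_le_of_small {k : ℕ} {γ : YoungDiagram}
    (h : γ.rowLen 0 + γ.colLen 0 ≤ k + 1) (r c : ℕ) : hookLen γ r c ≤ k := by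
  have h1 := γ.rowLen_anti 0 r (Nat.zero_le _)
  have h2 := γ.colLen_anti 0 c (Nat.zero_le _)
  unfold hookLen
  omega

lemma isCore_of_small {k : ℕ} {γ : YoungDiagram}
    (h : γ.rowLen 0 + γ.colLen 0 ≤ k + 1) : IsCore (k + 1) γ := fun c _ => by
  have := hookLen_le_of_small h c.1 c.2
  omega

lemma small_of_le {k : ℕ} {γ δ : YoungDiagram} (hδ : δ ≤ γ)
    (h : γ.rowLen 0 + γ.colLen 0 ≤ k + 1) : δ.rowLen 0 + δ.colLen 0 ≤ k + 1 := by
  have h1 : δ.rowLen 0 ≤ γ.rowLen 0 := by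
    by_contra! hlt
    have : (0, γ.rowLen 0) ∈ γ := hδ (YoungDiagram.mem_iff_lt_rowLen.2 hlt)
    exact lt_irrefl _ (YoungDiagram.mem_iff_lt_rowLen.1 this)
  have h2 : δ.colLen 0 ≤ γ.colLen 0 := by
    by_contra! hlt
    have : (γ.colLen 0, 0) ∈ γ := hδ (YoungDiagram.mem_iff_lt_colLen.2 hlt)
    exact lt_irrefl _ (YoungDiagram.mem_iff_lt_colLen.1 this)
  omega

lemma pRow_of_small {k : ℕ} {γ : YoungDiagram}
    (h : γ.rowLen 0 + γ.colLen 0 ≤ k + 1) (i : ℕ) : pRow k γ i = γ.rowLen i := by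
  rw [YoungDiagram.rowLen_eq_card, pRow, YoungDiagram.row]
  congr 1
  ext c
  simp [hookLen_le_of_small h]

lemma eq_of_rowLen_eq {γ δ : YoungDiagram} (h : ∀ i, γ.rowLen i = δ.rowLen i) : γ = δ := by
  ext ⟨i, j⟩
  simp only [YoungDiagram.mem_cells, YoungDiagram.mem_iff_lt_rowLen, h]

/-- In a row of a diagram, hook lengths weakly decrease from left to right. -/
lemma hookLen_anti_right (γ : YoungDiagram) (r : ℕ) {c d : ℕ} (h : c ≤ d) :
    hookLen γ r d ≤ hookLen γ r c := by
  have := γ.colLen_anti c d h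
  unfold hookLen
  omega

lemma rowLen_le_pRow_add {k : ℕ} {γ : YoungDiagram} {i m : ℕ}
    (h : ∀ c, m ≤ c → c < γ.rowLen i → hookLen γ i c ≤ k) : γ.rowLen i ≤ pRow k γ i + m := by
  have hsub : (Finset.Ico m (γ.rowLen i)).image (fun c => (i, c)) ⊆
      γ.cells.filter (fun c => c.1 = i ∧ hookLen γ c.1 c.2 ≤ k) := by
    intro c hc
    simp only [Finset.mem_image, Finset.mem_Ico] at hc
    obtain ⟨j, ⟨h1, h2⟩, rfl⟩ := hc
    exact Finset.mem_filter.2 ⟨(YoungDiagram.mem_cells _).2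
      (YoungDiagram.mem_iff_lt_rowLen.2 h2), rfl, h j h1 h2⟩
  have hcard := Finset.card_le_card hsub
  rw [Finset.card_image_of_injective _ (Prod.mk_right_injective i), Nat.card_Ico] at hcard
  unfold pRow
  omega

lemma pRow_le_rowLen (k : ℕ) (γ : YoungDiagram) (i : ℕ) : pRow k γ i ≤ γ.rowLen i := by
  rw [YoungDiagram.rowLen_eq_card, pRow, YoungDiagram.row]
  exact Finset.card_le_card (Finset.monotone_filter_right _ fun c _ hc => hc.1)

lemma eq_of_isCore_of_pRow_eq {k : ℕ} (hk : 1 ≤ k) {lam γ : YoungDiagram}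
    (h : lam.rowLen 0 + lam.colLen 0 ≤ k + 1) (hγ : IsCore (k + 1) γ)
    (hp : ∀ i, pRow k γ i = lam.rowLen i) : γ = lam := by
  have step : ∀ i, (∀ j, i < j → γ.rowLen j = lam.rowLen j) → γ.rowLen i = lam.rowLen i := by
    intro i hi
    refine le_antisymm ?_ (hp i ▸ pRow_le_rowLen k γ i)
    by_contra! hlt
    set m := γ.rowLen i - lam.rowLen i - 1 with hm
    have hmem : (i, m) ∈ γ := YoungDiagram.mem_iff_lt_rowLen.2 (by omega)
    have hcol : γ.colLen m ≤ max (i + 1) (lam.colLen 0) := by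
      by_contra! hc
      obtain ⟨hc1, hc2⟩ := max_lt_iff.1 hc
      have h1 : (max (i + 1) (lam.colLen 0), m) ∈ γ := YoungDiagram.mem_iff_lt_colLen.2 hc
      rw [YoungDiagram.mem_iff_lt_rowLen, hi _ (lt_of_lt_of_le (Nat.lt_succ_self i)
        (le_max_left _ _)), ← YoungDiagram.mem_iff_lt_rowLen,
        YoungDiagram.mem_iff_lt_colLen] at h1
      have := lam.colLen_anti 0 m (Nat.zero_le _)
      have := le_max_right (i + 1) (lam.colLen 0)
      omega
    have hrow := lam.rowLen_anti 0 i (Nat.zero_le _)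
    have hzero : lam.colLen 0 ≤ i → lam.rowLen i = 0 := by
      intro hle
      by_contra hne
      have : (i, 0) ∈ lam := YoungDiagram.mem_iff_lt_rowLen.2 (Nat.pos_of_ne_zero hne)
      have := YoungDiagram.mem_iff_lt_colLen.1 this
      omega
    have hhook : hookLen γ i m ≤ k := by
      have hne := hγ _ hmem
      simp only [hookLen] at hne ⊢
      rcases le_or_gt (lam.colLen 0) i with hle | hgt
      · have := hzero hle
        rw [max_eq_left (by omega)] at hcol
        omega
      · rw [max_eq_right (by omega)] at hcol
        omega
    have := rowLen_le_pRow_add (k := k) (γ := γ) (i := i) (m := m)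
      fun c hc _ => (hookLen_anti_right γ i hc).trans hhook
    rw [hp] at this
    omega
  have key : ∀ n i, γ.colLen 0 + lam.colLen 0 ≤ i + n → γ.rowLen i = lam.rowLen i := by
    intro n
    induction n with
    | zero =>
      intro i hi
      have hz : ∀ δ : YoungDiagram, δ.colLen 0 ≤ i → δ.rowLen i = 0 := by
        intro δ hle
        by_contra hne
        have : (i, 0) ∈ δ := YoungDiagram.mem_iff_lt_rowLen.2 (Nat.pos_of_ne_zero hne)
        have := YoungDiagram.mem_iff_lt_colLen.1 this
        omega
      rw [hz γ (by omega), hz lam (by omega)]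
    | succ n ih => exact fun i hi => step i fun j hj => ih j (by omega)
  exact eq_of_rowLen_eq fun i => key (γ.colLen 0 + lam.colLen 0) i (by omega)

lemma coreOf_eq_of_small {k : ℕ} (hk : 1 ≤ k) {lam : YoungDiagram}
    (h : lam.rowLen 0 + lam.colLen 0 ≤ k + 1) : coreOf k lam = lam := by
  have hex : ∃ γ, IsCore (k + 1) γ ∧ ∀ i, pRow k γ i = lam.rowLen i :=
    ⟨lam, isCore_of_small h, pRow_of_small h⟩
  have hs := Classical.epsilon_spec hex
  exact eq_of_isCore_of_pRow_eq hk h hs.1 hs.2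

/-! ## Residues in small diagrams -/

/-- In a small diagram, cells of equal residue lie on the same diagonal. -/
lemma diag_eq_of_residue_eq {k : ℕ} {γ : YoungDiagram}
    (h : γ.rowLen 0 + γ.colLen 0 ≤ k + 1) {c d : ℕ × ℕ} (hc : c ∈ γ) (hd : d ∈ γ)
    (hr : residue k c = residue k d) : c.2 + d.1 = d.2 + c.1 := by
  have bound : ∀ c : ℕ × ℕ, c ∈ γ → c.2 < γ.rowLen 0 ∧ c.1 < γ.colLen 0 := fun c hc =>
    ⟨(YoungDiagram.mem_iff_lt_rowLen.1 hc).trans_le (γ.rowLen_anti _ _ (Nat.zero_le _)),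
      (YoungDiagram.mem_iff_lt_colLen.1 hc).trans_le (γ.colLen_anti _ _ (Nat.zero_le _))⟩
  obtain ⟨hc2, hc1⟩ := bound c hc
  obtain ⟨hd2, hd1⟩ := bound d hd
  have h0 : (((c.2 : ℤ) - c.1 - (d.2 - d.1) : ℤ) : ZMod (k + 1)) = 0 := by
    unfold residue at hr
    push_cast
    rw [hr, sub_self]
  have hdvd := (ZMod.intCast_zmod_eq_zero_iff_dvd _ (k + 1)).1 h0
  have := Int.eq_zero_of_abs_lt_dvd hdvd (by rw [abs_lt]; constructor <;> push_cast <;> omega)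
  omega

lemma Removable.eq_of_diag_eq {δ : YoungDiagram} {c d : ℕ × ℕ} (hc : Removable δ c)
    (hd : Removable δ d) (h : c.2 + d.1 = d.2 + c.1) : c = d := by
  have key : ∀ a b : ℕ × ℕ, Removable δ a → Removable δ b → a.2 + b.1 = b.2 + a.1 →
      b.1 ≤ a.1 := by
    intro a b ha hb hab
    by_contra! hlt
    exact ha.2.1 (δ.isLowerSet (a := b) (Prod.mk_le_mk.2 ⟨hlt, by omega⟩) hb.1)
  have h1 := key c d hc hd h
  have h2 := key d c hd hc h.symm
  exact Prod.ext (by omega) (by omega)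

lemma Removable.eq_of_residue_eq {k : ℕ} {γ δ : YoungDiagram} (hδ : δ ≤ γ)
    (h : γ.rowLen 0 + γ.colLen 0 ≤ k + 1) {c d : ℕ × ℕ} (hc : Removable δ c)
    (hd : Removable δ d) (hr : residue k c = residue k d) : c = d :=
  hc.eq_of_diag_eq hd (diag_eq_of_residue_eq h (hδ hc.1) (hδ hd.1) hr)

/-! ## Monotonicity of set-valued fillings -/

namespace IsSVFilling

variable {γ : YoungDiagram} {e : ℕ × ℕ → Finset ℕ}

lemma mem (he : IsSVFilling γ e) {c : ℕ × ℕ} {x : ℕ} (hx : x ∈ e c) : c ∈ γ :=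
  (he.1 c).2 ⟨x, hx⟩

lemma row_mono (he : IsSVFilling γ e) {r c t : ℕ} :
    ∀ {x y : ℕ}, 0 < t → x ∈ e (r, c) → y ∈ e (r, c + t) → x ≤ y := by
  induction t with
  | zero => intro x y h; exact absurd h (lt_irrefl _)
  | succ t ih =>
    intro x y _ hx hy
    rcases Nat.eq_zero_or_pos t with rfl | ht
    · exact he.2.2.2 r c x hx y hy
    · obtain ⟨w, hw⟩ := (he.1 (r, c + t)).1
        (γ.isLowerSet (Prod.mk_le_mk.2 ⟨le_rfl, by omega⟩) (he.mem hy))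
      exact (ih ht hx hw).trans (he.2.2.2 r (c + t) w hw y hy)

lemma col_strictMono (he : IsSVFilling γ e) {r c t : ℕ} :
    ∀ {x y : ℕ}, 0 < t → x ∈ e (r, c) → y ∈ e (r + t, c) → x < y := by
  induction t with
  | zero => intro x y h; exact absurd h (lt_irrefl _)
  | succ t ih =>
    intro x y _ hx hy
    rcases Nat.eq_zero_or_pos t with rfl | ht
    · exact he.2.2.1 r c x hx y hy
    · obtain ⟨w, hw⟩ := (he.1 (r + t, c)).1
        (γ.isLowerSet (Prod.mk_le_mk.2 ⟨by omega, le_rfl⟩) (he.mem hy))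
      exact (ih ht hx hw).trans (he.2.2.1 (r + t) c w hw y hy)

lemma lt_of_row_lt (he : IsSVFilling γ e) {c d : ℕ × ℕ} {x y : ℕ} (hx : x ∈ e c)
    (hy : y ∈ e d) (h1 : c.1 < d.1) (h2 : c.2 ≤ d.2) : x < y := by
  obtain ⟨r, j⟩ := c
  obtain ⟨r', j'⟩ := d
  obtain ⟨s, rfl⟩ := Nat.exists_eq_add_of_lt h1
  obtain ⟨t, rfl⟩ := Nat.exists_eq_add_of_le h2
  rcases Nat.eq_zero_or_pos t with rfl | ht
  · exact he.col_strictMono (t := s + 1) (Nat.succ_pos s) hx hy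
  · obtain ⟨w, hw⟩ := (he.1 (r, j + t)).1
      (γ.isLowerSet (Prod.mk_le_mk.2 ⟨h1.le, le_rfl⟩) (he.mem hy))
    exact (he.row_mono ht hx hw).trans_lt (he.col_strictMono (t := s + 1) (Nat.succ_pos s) hw hy)

/-- The occurrences of a letter weakly descend from left to right. -/
lemma row_le_of_col_lt (he : IsSVFilling γ e) {c d : ℕ × ℕ} {x : ℕ} (hx : x ∈ e c)
    (hy : x ∈ e d) (h : c.2 < d.2) : d.1 ≤ c.1 := by
  by_contra! hlt
  exact lt_irrefl _ (he.lt_of_row_lt hx hy hlt h.le)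

lemma eq_of_col_eq (he : IsSVFilling γ e) {c d : ℕ × ℕ} {x : ℕ} (hx : x ∈ e c)
    (hy : x ∈ e d) (h : c.2 = d.2) : c = d := by
  rcases lt_trichotomy c.1 d.1 with h1 | h1 | h1
  · exact absurd (he.lt_of_row_lt hx hy h1 h.le) (lt_irrefl _)
  · exact Prod.ext h1 h
  · exact absurd (he.lt_of_row_lt hy hx h1 h.ge) (lt_irrefl _)

end IsSVFilling

/-! ## Blocks of letters -/

lemma sum_take_mono (α : List ℕ) : Monotone fun x => (α.take x).sum := by
  refine monotone_nat_of_le_succ fun x => ?_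
  rcases lt_or_ge x α.length with h | h
  · rw [List.sum_take_succ α x h]
    exact Nat.le_add_right _ _
  · rw [List.take_of_length_le h, List.take_of_length_le (h.trans (Nat.le_succ x))]

lemma sum_take_eq_add_getD (α : List ℕ) {x : ℕ} (h1 : 1 ≤ x) (h2 : x ≤ α.length) :
    (α.take x).sum = (α.take (x - 1)).sum + α.getD (x - 1) 0 := by
  obtain ⟨x, rfl⟩ := Nat.exists_eq_add_of_le' h1
  rw [Nat.add_sub_cancel, List.sum_take_succ α x h2, List.getD_eq_getElem α 0 h2]

lemma card_alphaBlock (α : List ℕ) {x : ℕ} (h1 : 1 ≤ x) (h2 : x ≤ α.length) :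
    (alphaBlock α x).card = α.getD (x - 1) 0 := by
  rw [alphaBlock, Nat.card_Ioc, sum_take_eq_add_getD α h1 h2, Nat.add_sub_cancel_left]

lemma mem_Icc_of_mem_alphaBlock {α : List ℕ} {x y : ℕ} (hy : y ∈ alphaBlock α x) :
    1 ≤ y ∧ y ≤ α.sum := by
  rw [alphaBlock, Finset.mem_Ioc] at hy
  have := sum_take_mono α (le_max_left x α.length)
  simp only [List.take_of_length_le (le_max_right x α.length)] at this
  omega

lemma lt_of_mem_alphaBlock {α : List ℕ} {x x' y y' : ℕ} (hy : y ∈ alphaBlock α x)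
    (hy' : y' ∈ alphaBlock α x') (h : x < x') : y < y' := by
  rw [alphaBlock, Finset.mem_Ioc] at hy hy'
  have := sum_take_mono α (show x ≤ x' - 1 by omega)
  simp only at this
  omega

lemma blockOf_spec {α : List ℕ} {y : ℕ} (h1 : 1 ≤ y) (h2 : y ≤ α.sum) :
    1 ≤ blockOf α y ∧ blockOf α y ≤ α.length ∧ y ∈ alphaBlock α (blockOf α y) := by
  have hmem : α.length ∈ {x : ℕ | y ≤ (α.take x).sum} := by simpa using h2
  have hs : y ≤ (α.take (blockOf α y)).sum := Nat.sInf_mem ⟨_, hmem⟩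
  have hpos : 1 ≤ blockOf α y := by
    by_contra! h0
    rw [Nat.lt_one_iff.1 h0] at hs
    simp at hs
    omega
  refine ⟨hpos, Nat.sInf_le hmem, ?_⟩
  rw [alphaBlock, Finset.mem_Ioc]
  refine ⟨?_, hs⟩
  by_contra! hle
  have : blockOf α y ≤ blockOf α y - 1 := Nat.sInf_le hle
  omega

lemma blockOf_eq_of_mem {α : List ℕ} {x y : ℕ} (hy : y ∈ alphaBlock α x) :
    blockOf α y = x := by
  obtain ⟨h1, h2⟩ := mem_Icc_of_mem_alphaBlock hy
  have hb := (blockOf_spec h1 h2).2.2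
  rcases lt_trichotomy (blockOf α y) x with h | h | h
  · exact absurd (lt_of_mem_alphaBlock hb hy h) (lt_irrefl _)
  · exact h
  · exact absurd (lt_of_mem_alphaBlock hy hb h) (lt_irrefl _)

lemma blockOf_mono_of_le {α : List ℕ} {y z : ℕ} (hy : 1 ≤ y) (hz : z ≤ α.sum) (h : y ≤ z) :
    blockOf α y ≤ blockOf α z := by
  by_contra! hlt
  have := lt_of_mem_alphaBlock (blockOf_spec (hy.trans h) hz).2.2
    (blockOf_spec hy (h.trans hz)).2.2 hlt
  omega

/-! ## From affine set-valued tableaux to set-valued tableaux -/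

namespace IsASVT

variable {k : ℕ} {α : List ℕ} {lam : YoungDiagram} {e : ℕ × ℕ → Finset ℕ}

lemma mem_Icc (he : IsASVT k α lam e) {c : ℕ × ℕ} {y : ℕ} (hy : y ∈ e c) :
    1 ≤ y ∧ y ≤ α.sum :=
  ⟨he.1.1.2.1 c y hy, he.1.2.1 c y hy⟩

lemma exists_cell (he : IsASVT k α lam e) {y : ℕ} (h1 : 1 ≤ y) (h2 : y ≤ α.sum) :
    ∃ c, y ∈ e c := by
  obtain ⟨_, _, _, _, h, _⟩ := he.1.2.2 y h1 h2
  exact h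

/-- In a small shape, each letter occupies a single cell. -/
lemma cell_unique (he : IsASVT k α lam e) (h : lam.rowLen 0 + lam.colLen 0 ≤ k + 1)
    {c d : ℕ × ℕ} {y : ℕ} (hc : y ∈ e c) (hd : y ∈ e d) : c = d := by
  obtain ⟨h1, h2⟩ := he.mem_Icc hc
  obtain ⟨δ, _, hδ, i, _, hi⟩ := he.1.2.2 y h1 h2
  have hle : δ ≤ lam := by
    rw [← YoungDiagram.cells_subset_iff, hδ]
    exact Finset.filter_subset _ _
  obtain ⟨hc1, hc2⟩ := (hi c).1 hc
  obtain ⟨hd1, hd2⟩ := (hi d).1 hd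
  exact hc1.eq_of_residue_eq hle h hd1 (hc2.trans hd2.symm)

lemma isLowestOcc (he : IsASVT k α lam e) (h : lam.rowLen 0 + lam.colLen 0 ≤ k + 1)
    {c : ℕ × ℕ} {y : ℕ} (hc : y ∈ e c) : IsLowestOcc e y c :=
  ⟨hc, fun _ hd => (congrArg Prod.fst (he.cell_unique h hc hd)).le⟩

/-- Within a block, larger letters lie strictly further to the right. -/
lemma col_lt (he : IsASVT k α lam e) (h : lam.rowLen 0 + lam.colLen 0 ≤ k + 1)
    {x y z : ℕ} (hx1 : 1 ≤ x) (hx2 : x ≤ α.length) (hy : y ∈ alphaBlock α x)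
    (hz : z ∈ alphaBlock α x) (hyz : y < z) {c d : ℕ × ℕ} (hc : y ∈ e c) (hd : z ∈ e d) :
    c.2 < d.2 := by
  rcases (he.2 x hx1 hx2).1 y z hy hz hyz c d (he.isLowestOcc h hc) (he.isLowestOcc h hd) with
    hr | hr
  · by_contra! hle
    exact lt_asymm hyz (he.1.1.lt_of_row_lt hd hc hr hle)
  · exact hr.2

lemma mem_image_blockOf_iff (he : IsASVT k α lam e) {c : ℕ × ℕ} {x : ℕ} :
    x ∈ (e c).image (blockOf α) ↔ ∃ y ∈ alphaBlock α x, y ∈ e c := by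
  rw [Finset.mem_image]
  constructor
  · rintro ⟨y, hy, rfl⟩
    exact ⟨y, (blockOf_spec (he.mem_Icc hy).1 (he.mem_Icc hy).2).2.2, hy⟩
  · rintro ⟨y, hy, hyc⟩
    exact ⟨y, hyc, blockOf_eq_of_mem hy⟩

/-- Counting the cells of a block by their letters. -/
lemma card_cells_eq (he : IsASVT k α lam e) (h : lam.rowLen 0 + lam.colLen 0 ≤ k + 1)
    {x : ℕ} (hx1 : 1 ≤ x) (hx2 : x ≤ α.length) {P : ℕ × ℕ → Prop} {Q : ℕ → Prop}
    [DecidablePred P] [DecidablePred Q]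
    (hPQ : ∀ c, ∀ y ∈ alphaBlock α x, y ∈ e c → (P c ↔ Q y)) :
    (lam.cells.filter fun c => x ∈ (e c).image (blockOf α) ∧ P c).card =
      ((alphaBlock α x).filter Q).card := by
  have hex : ∀ y, ∃ c, y ∈ alphaBlock α x → y ∈ e c := by
    intro y
    by_cases hy : y ∈ alphaBlock α x
    · obtain ⟨h1, h2⟩ := mem_Icc_of_mem_alphaBlock hy
      obtain ⟨c, hc⟩ := he.exists_cell h1 h2
      exact ⟨c, fun _ => hc⟩
    · exact ⟨0, fun h => absurd h hy⟩
  choose f hf using hex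
  symm
  refine Finset.card_bij (fun y _ => f y) ?_ ?_ ?_
  · intro y hy
    obtain ⟨hy1, hy2⟩ := Finset.mem_filter.1 hy
    have hfy := hf y hy1
    rw [Finset.mem_filter, he.mem_image_blockOf_iff]
    exact ⟨he.1.1.mem hfy, ⟨y, hy1, hfy⟩, (hPQ _ y hy1 hfy).2 hy2⟩
  · intro y hy z hz hyz
    have hy1 := (Finset.mem_filter.1 hy).1
    have hz1 := (Finset.mem_filter.1 hz).1
    rcases lt_trichotomy y z with hlt | heq | hlt
    · exact absurd (he.col_lt h hx1 hx2 hy1 hz1 hlt (hf y hy1) (hf z hz1)) (by rw [hyz]; omega)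
    · exact heq
    · exact absurd (he.col_lt h hx1 hx2 hz1 hy1 hlt (hf z hz1) (hf y hy1)) (by rw [hyz]; omega)
  · intro c hc
    rw [Finset.mem_filter, he.mem_image_blockOf_iff] at hc
    obtain ⟨_, ⟨y, hy, hyc⟩, hP⟩ := hc
    exact ⟨y, Finset.mem_filter.2 ⟨hy, (hPQ c y hy hyc).1 hP⟩,
      he.cell_unique h (hf y hy) hyc⟩

lemma isSVT_image (he : IsASVT k α lam e) (h : lam.rowLen 0 + lam.colLen 0 ≤ k + 1) :
    IsSVT α lam fun c => (e c).image (blockOf α) := by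
  refine ⟨⟨?_, ?_, ?_, ?_⟩, ?_, ?_⟩
  · intro c
    rw [Finset.image_nonempty]
    exact he.1.1.1 c
  · intro c x hx
    obtain ⟨y, hy, rfl⟩ := Finset.mem_image.1 hx
    exact (blockOf_spec (he.mem_Icc hy).1 (he.mem_Icc hy).2).1
  · intro r c x hx x' hx'
    obtain ⟨y, hy, rfl⟩ := Finset.mem_image.1 hx
    obtain ⟨z, hz, rfl⟩ := Finset.mem_image.1 hx'
    have hyz := he.1.1.2.2.1 r c y hy z hz
    refine lt_of_le_of_ne (blockOf_mono_of_le (he.mem_Icc hy).1 (he.mem_Icc hz).2 hyz.le) ?_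
    intro heq
    obtain ⟨h1, h2, hyb⟩ := blockOf_spec (he.mem_Icc hy).1 (he.mem_Icc hy).2
    have hzb := (blockOf_spec (he.mem_Icc hz).1 (he.mem_Icc hz).2).2.2
    rw [← heq] at hzb
    exact lt_irrefl c (he.col_lt h h1 h2 hyb hzb hyz hy hz)
  · intro r c x hx x' hx'
    obtain ⟨y, hy, rfl⟩ := Finset.mem_image.1 hx
    obtain ⟨z, hz, rfl⟩ := Finset.mem_image.1 hx'
    exact blockOf_mono_of_le (he.mem_Icc hy).1 (he.mem_Icc hz).2 (he.1.1.2.2.2 r c y hy z hz)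
  · intro c x hx
    obtain ⟨y, hy, rfl⟩ := Finset.mem_image.1 hx
    exact (blockOf_spec (he.mem_Icc hy).1 (he.mem_Icc hy).2).2.1
  · intro x h1 h2
    have := he.card_cells_eq h h1 h2 (P := fun _ => True) (Q := fun _ => True)
      fun _ _ _ _ => Iff.rfl
    simp only [and_true, Finset.filter_true] at this
    rw [this, card_alphaBlock α h1 h2]

end IsASVT

/-! ## Standardization of set-valued tableaux -/

/-- The letter replacing the occurrence of `x` in the cell `c` when the occurrences of `x` are
relabelled from left to right by the letters of the block of `x`. -/
noncomputable def stdLetter (α : List ℕ) (lam : YoungDiagram) (u : ℕ × ℕ → Finset ℕ)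
    (c : ℕ × ℕ) (x : ℕ) : ℕ :=
  (α.take (x - 1)).sum + (lam.cells.filter fun d => x ∈ u d ∧ d.2 < c.2).card + 1

/-- The standardization of a set-valued tableau of weight `α`. -/
noncomputable def standardize (α : List ℕ) (lam : YoungDiagram) (u : ℕ × ℕ → Finset ℕ)
    (c : ℕ × ℕ) : Finset ℕ :=
  (u c).image (stdLetter α lam u c)

lemma IsASVT.standardize_image {k : ℕ} {α : List ℕ} {lam : YoungDiagram}
    {e : ℕ × ℕ → Finset ℕ} (he : IsASVT k α lam e)
    (h : lam.rowLen 0 + lam.colLen 0 ≤ k + 1) :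
    standardize α lam (fun c => (e c).image (blockOf α)) = e := by
  funext c
  rw [standardize, Finset.image_image]
  conv_rhs => rw [← Finset.image_id (s := e c)]
  refine Finset.image_congr fun z hz => ?_
  obtain ⟨h1, h2, hzb⟩ := blockOf_spec (he.mem_Icc hz).1 (he.mem_Icc hz).2
  set x := blockOf α z with hx
  have hcard := he.card_cells_eq h h1 h2 (P := fun d => d.2 < c.2) (Q := fun y => y < z) (by
    intro d y hy hyd
    constructor
    · intro hlt
      by_contra! hle
      rcases hle.eq_or_lt with rfl | hlt'
      · rw [he.cell_unique h hyd hz] at hlt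
        exact lt_irrefl _ hlt
      · exact lt_asymm hlt (he.col_lt h h1 h2 hzb hy hlt' hz hyd)
    · exact fun hlt => he.col_lt h h1 h2 hy hzb hlt hyd hz)
  have hIoo : (alphaBlock α x).filter (fun y => y < z) =
      Finset.Ioo ((α.take (x - 1)).sum) z := by
    ext y
    rw [alphaBlock, Finset.mem_Ioc] at hzb
    simp only [alphaBlock, Finset.mem_filter, Finset.mem_Ioc, Finset.mem_Ioo]
    omega
  rw [hIoo, Nat.card_Ioo] at hcard
  rw [alphaBlock, Finset.mem_Ioc] at hzb
  simp only [Function.comp_apply, stdLetter, ← hx, id_eq]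
  rw [hcard]
  omega

namespace IsSVT

variable {α : List ℕ} {lam : YoungDiagram} {u : ℕ × ℕ → Finset ℕ}

lemma mem_Icc (hu : IsSVT α lam u) {c : ℕ × ℕ} {x : ℕ} (hx : x ∈ u c) :
    1 ≤ x ∧ x ≤ α.length :=
  ⟨hu.1.2.1 c x hx, hu.2.1 c x hx⟩

lemma stdLetter_mem (hu : IsSVT α lam u) {c : ℕ × ℕ} {x : ℕ} (hx : x ∈ u c) :
    stdLetter α lam u c x ∈ alphaBlock α x := by
  obtain ⟨h1, h2⟩ := hu.mem_Icc hx
  have hlt : (lam.cells.filter fun d => x ∈ u d ∧ d.2 < c.2).card <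
      (lam.cells.filter fun d => x ∈ u d).card := by
    refine Finset.card_lt_card ⟨Finset.monotone_filter_right _ fun d _ hd => hd.1, fun hsub => ?_⟩
    have := hsub (Finset.mem_filter.2 ⟨(YoungDiagram.mem_cells _).2 (hu.1.mem hx), hx⟩)
    exact lt_irrefl _ (Finset.mem_filter.1 this).2.2
  rw [hu.2.2 x h1 h2] at hlt
  rw [alphaBlock, Finset.mem_Ioc, sum_take_eq_add_getD α h1 h2, stdLetter]
  omega

lemma stdLetter_lt_of_col_lt (hu : IsSVT α lam u) {c d : ℕ × ℕ} {x : ℕ} (hx : x ∈ u c)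
    (h : c.2 < d.2) : stdLetter α lam u c x < stdLetter α lam u d x := by
  have hlt : (lam.cells.filter fun b => x ∈ u b ∧ b.2 < c.2).card <
      (lam.cells.filter fun b => x ∈ u b ∧ b.2 < d.2).card := by
    refine Finset.card_lt_card
      ⟨Finset.monotone_filter_right _ fun b _ hb => ⟨hb.1, hb.2.trans h⟩, fun hsub => ?_⟩
    have := hsub (Finset.mem_filter.2 ⟨(YoungDiagram.mem_cells _).2 (hu.1.mem hx), hx, h⟩)
    exact lt_irrefl _ (Finset.mem_filter.1 this).2.2
  unfold stdLetter
  omega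

lemma blockOf_stdLetter (hu : IsSVT α lam u) {c : ℕ × ℕ} {x : ℕ} (hx : x ∈ u c) :
    blockOf α (stdLetter α lam u c x) = x :=
  blockOf_eq_of_mem (hu.stdLetter_mem hx)

lemma image_standardize (hu : IsSVT α lam u) :
    (fun c => (standardize α lam u c).image (blockOf α)) = u := by
  funext c
  simp only [standardize]
  rw [Finset.image_image]
  conv_rhs => rw [← Finset.image_id (s := u c)]
  exact Finset.image_congr fun x hx => hu.blockOf_stdLetter hx

lemma mem_standardize_iff (hu : IsSVT α lam u) {c : ℕ × ℕ} {x y : ℕ}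
    (hy : y ∈ alphaBlock α x) :
    y ∈ standardize α lam u c ↔ x ∈ u c ∧ stdLetter α lam u c x = y := by
  rw [standardize, Finset.mem_image]
  constructor
  · rintro ⟨x', hx', rfl⟩
    have : x' = x := (hu.blockOf_stdLetter hx').symm.trans (blockOf_eq_of_mem hy)
    subst this
    exact ⟨hx', rfl⟩
  · rintro ⟨hx, hxy⟩
    exact ⟨x, hx, hxy⟩

lemma exists_block (hu : IsSVT α lam u) {c : ℕ × ℕ} {y : ℕ}
    (hy : y ∈ standardize α lam u c) : ∃ x, y ∈ alphaBlock α x := by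
  obtain ⟨x, hx, rfl⟩ := Finset.mem_image.1 hy
  exact ⟨x, hu.stdLetter_mem hx⟩

lemma standardize_cell_unique (hu : IsSVT α lam u) {c d : ℕ × ℕ} {y : ℕ}
    (hc : y ∈ standardize α lam u c) (hd : y ∈ standardize α lam u d) : c = d := by
  obtain ⟨x, hx⟩ := hu.exists_block hc
  obtain ⟨hc1, hc2⟩ := (hu.mem_standardize_iff hx).1 hc
  obtain ⟨hd1, hd2⟩ := (hu.mem_standardize_iff hx).1 hd
  rcases lt_trichotomy c.2 d.2 with h | h | h
  · have := hu.stdLetter_lt_of_col_lt hc1 h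
    omega
  · exact hu.1.eq_of_col_eq hc1 hd1 h
  · have := hu.stdLetter_lt_of_col_lt hd1 h
    omega

lemma isSVFilling_standardize (hu : IsSVT α lam u) :
    IsSVFilling lam (standardize α lam u) := by
  refine ⟨?_, ?_, ?_, ?_⟩
  · intro c
    rw [standardize, Finset.image_nonempty]
    exact hu.1.1 c
  · intro c y hy
    obtain ⟨x, _, rfl⟩ := Finset.mem_image.1 hy
    exact Nat.succ_pos _
  · intro r c y hy z hz
    obtain ⟨x, hx, rfl⟩ := Finset.mem_image.1 hy
    obtain ⟨x', hx', rfl⟩ := Finset.mem_image.1 hz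
    exact lt_of_mem_alphaBlock (hu.stdLetter_mem hx) (hu.stdLetter_mem hx')
      (hu.1.2.2.1 r c x hx x' hx')
  · intro r c y hy z hz
    obtain ⟨x, hx, rfl⟩ := Finset.mem_image.1 hy
    obtain ⟨x', hx', rfl⟩ := Finset.mem_image.1 hz
    rcases (hu.1.2.2.2 r c x hx x' hx').eq_or_lt with rfl | hlt
    · exact (hu.stdLetter_lt_of_col_lt hx (Nat.lt_succ_self c)).le
    · exact (lt_of_mem_alphaBlock (hu.stdLetter_mem hx) (hu.stdLetter_mem hx') hlt).le

lemma exists_mem_standardize (hu : IsSVT α lam u) {y : ℕ} (h1 : 1 ≤ y) (h2 : y ≤ α.sum) :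
    ∃ c, y ∈ standardize α lam u c := by
  obtain ⟨hx1, hx2, hy⟩ := blockOf_spec h1 h2
  set x := blockOf α y
  obtain ⟨c, hc, hcy⟩ := Finset.surj_on_of_inj_on_of_card_le
    (s := lam.cells.filter fun c => x ∈ u c) (t := alphaBlock α x)
    (fun c _ => stdLetter α lam u c x)
    (fun c hc => hu.stdLetter_mem (Finset.mem_filter.1 hc).2)
    (fun c d hc hd hcd => by
      have hc1 := (Finset.mem_filter.1 hc).2
      have hd1 := (Finset.mem_filter.1 hd).2
      exact hu.standardize_cell_unique (Finset.mem_image_of_mem _ hc1)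
        (hcd ▸ Finset.mem_image_of_mem _ hd1))
    (by rw [hu.2.2 x hx1 hx2, card_alphaBlock α hx1 hx2]) y hy
  exact ⟨c, (hu.mem_standardize_iff hy).2 ⟨(Finset.mem_filter.1 hc).2, hcy.symm⟩⟩

lemma isStdASVT_standardize {k : ℕ} (hu : IsSVT α lam u)
    (h : lam.rowLen 0 + lam.colLen 0 ≤ k + 1) :
    IsStdASVT k α.sum lam (standardize α lam u) := by
  have hs := hu.isSVFilling_standardize
  refine ⟨hs, ?_, ?_⟩
  · intro c y hy
    obtain ⟨x, hx⟩ := hu.exists_block hy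
    exact (mem_Icc_of_mem_alphaBlock hx).2
  · intro z h1 h2
    have hlower : IsLowerSet (shapeLe lam (standardize α lam u) z : Set (ℕ × ℕ)) := by
      intro d c hcd hd
      simp only [shapeLe, Finset.coe_filter, Set.mem_ofPred_eq, YoungDiagram.mem_cells] at hd ⊢
      obtain ⟨hd, y, hy, hyz⟩ := hd
      have hc := lam.isLowerSet hcd hd
      obtain ⟨w, hw⟩ := (hs.1 c).1 hc
      rcases hcd.1.lt_or_eq with hlt | heq
      · exact ⟨hc, w, hw, (hs.lt_of_row_lt hw hy hlt hcd.2).le.trans hyz⟩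
      · obtain ⟨r, j⟩ := c
        obtain ⟨r', j'⟩ := d
        obtain rfl : r = r' := heq
        obtain ⟨t, rfl⟩ := Nat.exists_eq_add_of_le hcd.2
        rcases Nat.eq_zero_or_pos t with rfl | ht
        · exact ⟨hc, y, hy, hyz⟩
        · exact ⟨hc, w, hw, (hs.row_mono ht hw hy).trans hyz⟩
    set δ : YoungDiagram := ⟨shapeLe lam (standardize α lam u) z, hlower⟩ with hδ
    have hmem : ∀ c, c ∈ δ ↔ c ∈ lam ∧ ∃ y ∈ standardize α lam u c, y ≤ z := fun c => by
      rw [← YoungDiagram.mem_cells]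
      simp [hδ, shapeLe]
    have hle : δ ≤ lam := fun c hc => ((hmem c).1 hc).1
    obtain ⟨c₀, hc₀⟩ := hu.exists_mem_standardize h1 h2
    have hrem : ∀ c, z ∈ standardize α lam u c → Removable δ c := by
      intro c hc
      refine ⟨(hmem c).2 ⟨hs.mem hc, z, hc, le_rfl⟩, fun hup => ?_, fun hright => ?_⟩
      · obtain ⟨_, y, hy, hyz⟩ := (hmem _).1 hup
        exact absurd (hs.2.2.1 c.1 c.2 z hc y hy) (by omega)
      · obtain ⟨_, y, hy, hyz⟩ := (hmem _).1 hright
        have hzy := hs.2.2.2 c.1 c.2 z hc y hy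
        obtain rfl : y = z := le_antisymm hyz hzy
        have := congrArg Prod.snd (hu.standardize_cell_unique hc hy)
        simp at this
    refine ⟨δ, isCore_of_small (small_of_le hle h), rfl, residue k c₀, ⟨c₀, hc₀⟩, fun c => ?_⟩
    constructor
    · intro hc
      exact ⟨hrem c hc, by rw [hu.standardize_cell_unique hc hc₀]⟩
    · rintro ⟨hc, hr⟩
      rw [hc.eq_of_residue_eq hle h (hrem c₀ hc₀) hr]
      exact hc₀

lemma isASVT_standardize {k : ℕ} (hu : IsSVT α lam u)
    (h : lam.rowLen 0 + lam.colLen 0 ≤ k + 1) :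
    IsASVT k α lam (standardize α lam u) := by
  refine ⟨hu.isStdASVT_standardize h, fun x hx1 hx2 => ?_⟩
  have hblock : ∀ c, (∃ y ∈ alphaBlock α x, y ∈ standardize α lam u c) ↔ x ∈ u c := by
    intro c
    constructor
    · rintro ⟨y, hy, hyc⟩
      exact ((hu.mem_standardize_iff hy).1 hyc).1
    · exact fun hx => ⟨_, hu.stdLetter_mem hx, Finset.mem_image_of_mem _ hx⟩
  refine ⟨?_, ?_, ?_⟩
  · intro y z hy hz hyz c d hc hd
    obtain ⟨hc1, hc2⟩ := (hu.mem_standardize_iff hy).1 hc.1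
    obtain ⟨hd1, hd2⟩ := (hu.mem_standardize_iff hz).1 hd.1
    have hcol : c.2 < d.2 := by
      by_contra! hle
      rcases hle.eq_or_lt with heq | hlt
      · rw [hu.1.eq_of_col_eq hd1 hc1 heq] at hd2
        omega
      · have := hu.stdLetter_lt_of_col_lt hd1 hlt
        omega
    rcases (hu.1.row_le_of_col_lt hc1 hd1 hcol).lt_or_eq with hlt | heq
    · exact Or.inl hlt
    · exact Or.inr ⟨heq.symm, hcol⟩
  · simp only [hblock]
    rw [Finset.card_image_of_injOn, hu.2.2 x hx1 hx2]
    intro c hc d hd hr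
    obtain ⟨hc1, hc2⟩ := Finset.mem_filter.1 hc
    obtain ⟨hd1, hd2⟩ := Finset.mem_filter.1 hd
    have hdiag := diag_eq_of_residue_eq h hc1 hd1 hr
    rcases lt_trichotomy c.2 d.2 with hlt | heq | hlt
    · have := hu.1.row_le_of_col_lt hc2 hd2 hlt
      omega
    · exact hu.1.eq_of_col_eq hc2 hd2 heq
    · have := hu.1.row_le_of_col_lt hd2 hc2 hlt
      omega
  · intro c d hc hd hcd
    exact hu.1.eq_of_col_eq ((hblock c).1 hc) ((hblock d).1 hd) hcd

end IsSVT

/-- Let `λ` be a `k`-bounded partition whose largest hook length satisfies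
`λ₁ + ℓ(λ) - 1 ≤ k` (so that `𝔠(λ) = λ`).  Then, for every `k`-bounded composition `α`, the
map that replaces each letter of `𝒜_{α,x}` by `x` is a bijection from `𝒯^k_α(λ)` onto the
set of set-valued tableaux of shape `λ` and weight `α`: the affine set-valued tableaux of
shape `λ` are exactly the set-valued tableaux of shape `λ`. -/
theorem asvt_eq_svt_of_small_hook
    (k : ℕ) (hk : 1 ≤ k) (lam : YoungDiagram) (hlam : IsKBounded k lam)
    (hhook : lam.rowLen 0 + lam.colLen 0 ≤ k + 1)
    (α : List ℕ) (hα : IsKBoundedComp k α) :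
    Set.BijOn (fun (e : ℕ × ℕ → Finset ℕ) => fun c => (e c).image (blockOf α))
      {e | IsASVT k α (coreOf k lam) e} {e | IsSVT α lam e} := by
  rw [coreOf_eq_of_small hk hhook]
  exact Set.InvOn.bijOn (f' := standardize α lam)
    ⟨fun e he => IsASVT.standardize_image he hhook, fun u hu => IsSVT.image_standardize hu⟩
    (fun e he => IsASVT.isSVT_image he hhook) fun u hu => IsSVT.isASVT_standardize hu hhook

end AffineKTheory
end

section
/- If γ/β is an affine r-strip with r ≥ 1 and i is the residue of its rightmost cell (the cell of γ/β in the rightmost occupied column), then γ̂/β is an affine (r−1)-strip, where γ̂ is the shape obtained from γ by deleting all removable i-corners of γ. -/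
open scoped Classical

namespace AffineKTheory

/-! ## Strips -/

/-- `γ/β` is a horizontal strip: `β ⊆ γ` with at most one cell of `γ/β` in each column. -/
def IsHorizontalStrip (β γ : YoungDiagram) : Prop :=
  β ≤ γ ∧ ∀ c d : ℕ × ℕ, c ∈ γ → c ∉ β → d ∈ γ → d ∉ β → c.2 = d.2 → c = d

/-- `Res(γ/β)`: the set of residues of the cells of `γ/β`. -/
noncomputable def resSet (k : ℕ) (β γ : YoungDiagram) : Finset (ZMod (k + 1)) :=
  (γ.cells \ β.cells).image (residue k)

/-- An affine `r`-strip `γ/β` (for `0 ≤ r ≤ k`): a horizontal strip of `(k+1)`-cores with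
`|𝔭(γ)| = |𝔭(β)| + r` occupying exactly `r` distinct residues. -/
def IsAffineStrip (k r : ℕ) (β γ : YoungDiagram) : Prop :=
  r ≤ k ∧ IsCore (k + 1) β ∧ IsCore (k + 1) γ ∧ IsHorizontalStrip β γ ∧
  pSize k γ = pSize k β + r ∧ (resSet k β γ).card = r

/-- An affine set-valued `r`-strip `(γ/β, ρ)` (for `0 ≤ r ≤ k`), with `(k+1)`-cores
`ρ ⊆ β ⊆ γ`:  (asv1) `γ/ρ` is a horizontal strip; (asv2) `γ/β` is an affine `(r-m)`-strip
where `m = |Res(β/ρ)|`; (asv3) `β/ρ` consists of `β`-removable corners, and if a cell of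
residue `i` lies in `β/ρ` then every `β`-removable `i`-corner that is not `γ`-blocked lies
in `β/ρ`. -/
def IsAffineSVStrip (k r : ℕ) (ρ β γ : YoungDiagram) : Prop :=
  r ≤ k ∧ IsCore (k + 1) ρ ∧ ρ ≤ β ∧
  IsHorizontalStrip ρ γ ∧
  (resSet k ρ β).card ≤ r ∧
  IsAffineStrip k (r - (resSet k ρ β).card) β γ ∧
  (∀ c : ℕ × ℕ, c ∈ β → c ∉ ρ → Removable β c) ∧
  (∀ c : ℕ × ℕ, c ∈ β → c ∉ ρ → ∀ c' : ℕ × ℕ, Removable β c' →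
    residue k c' = residue k c → ¬ Blocked γ c' → c' ∉ ρ)

/-- The finite set of addable corners of `γ` with residue `i`. -/
noncomputable def addableSet (k : ℕ) (i : ZMod (k + 1)) (γ : YoungDiagram) : Finset (ℕ × ℕ) :=
  ((Finset.range (γ.colLen 0 + 1)).image fun r => (r, γ.rowLen r)).filter
    fun c => Addable γ c ∧ residue k c = i

/-- The operator `𝔰_i`: add to `γ` all its addable corners of residue `i`. -/
noncomputable def addCorners (k : ℕ) (i : ZMod (k + 1)) (γ : YoungDiagram) : YoungDiagram where
  cells := γ.cells ∪ addableSet k i γ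
  isLowerSet := by
    intro a b hba ha
    simp only [Finset.coe_union, Set.mem_union, Finset.mem_coe] at ha ⊢
    rcases ha with ha | ha
    · exact Or.inl (γ.isLowerSet hba ha)
    · have haddable : Addable γ a := ((Finset.mem_filter.mp ha).2).1
      by_cases hab : b = a
      · exact Or.inr (hab ▸ ha)
      · exact Or.inl (haddable.2 b hba hab)



/-- The bead positions of `γ` (its Maya diagram): the contents of the cells just after the end
of each row. -/
def Bead (γ : YoungDiagram) (x : ℤ) : Prop :=
  ∃ r : ℕ, x = (γ.rowLen r : ℤ) - r

/-- Some cell of `γ/β` has content `x`. -/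
def StripContent (β γ : YoungDiagram) (x : ℤ) : Prop :=
  ∃ r : ℕ, (β.rowLen r : ℤ) - r ≤ x ∧ x < (γ.rowLen r : ℤ) - r

/-- The content of a cell. -/
def content (c : ℕ × ℕ) : ℤ := (c.2 : ℤ) - c.1

theorem residue_eq_content (k : ℕ) (c : ℕ × ℕ) :
    residue k c = ((content c : ℤ) : ZMod (k + 1)) := by
  simp [residue, content]

theorem stripContent_iff {β γ : YoungDiagram} {x : ℤ} :
    StripContent β γ x ↔ ∃ c : ℕ × ℕ, c ∈ γ ∧ c ∉ β ∧ content c = x := by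
  constructor
  · rintro ⟨r, h₁, h₂⟩
    refine ⟨(r, (x + r).toNat), ?_, ?_, ?_⟩
    · rw [YoungDiagram.mem_iff_lt_rowLen]; omega
    · rw [YoungDiagram.mem_iff_lt_rowLen]; omega
    · simp only [content]; omega
  · rintro ⟨⟨r, c⟩, h₁, h₂, rfl⟩
    rw [YoungDiagram.mem_iff_lt_rowLen] at h₁ h₂
    exact ⟨r, by simp only [content]; omega, by simp only [content]; omega⟩

/-- A column whose top cell has content `x` witnesses that `x` is not a bead, and conversely. -/
theorem not_bead_iff {γ : YoungDiagram} {x : ℤ} :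
    ¬ Bead γ x ↔ ∃ c : ℕ, x = (c : ℤ) + 1 - γ.colLen c := by
  constructor
  · intro h
    have hex : ∃ r : ℕ, (γ.rowLen r : ℤ) - r ≤ x := by
      refine ⟨(γ.rowLen 0 - x).toNat, ?_⟩
      have := γ.rowLen_anti 0 (γ.rowLen 0 - x).toNat (Nat.zero_le _)
      omega
    set r := Nat.find hex with hr
    have h₁ : (γ.rowLen r : ℤ) - r ≤ x := Nat.find_spec hex
    have h₂ : (γ.rowLen r : ℤ) - r ≠ x := fun e => h ⟨r, e.symm⟩
    refine ⟨(x + r - 1).toNat, ?_⟩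
    have hcol : γ.colLen (x + r - 1).toNat = r := by
      apply le_antisymm
      · by_contra! hlt
        rw [← YoungDiagram.mem_iff_lt_colLen, YoungDiagram.mem_iff_lt_rowLen] at hlt
        omega
      · by_contra! hlt
        have hm := Nat.find_min hex (m := r - 1) (by omega)
        have : (r - 1, (x + r - 1).toNat) ∈ γ := by
          rw [YoungDiagram.mem_iff_lt_rowLen]; omega
        rw [YoungDiagram.mem_iff_lt_colLen] at this
        omega
    rw [hcol]; omega
  · rintro ⟨c, rfl⟩ ⟨s, hs⟩
    have h₁ : (s, c) ∈ γ ↔ c < γ.rowLen s := YoungDiagram.mem_iff_lt_rowLen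
    have h₂ : (s, c) ∈ γ ↔ s < γ.colLen c := YoungDiagram.mem_iff_lt_colLen
    by_cases hm : (s, c) ∈ γ
    · have := h₁.1 hm; have := h₂.1 hm; omega
    · have := mt h₁.2 hm; have := mt h₂.2 hm; omega

theorem isCore_iff_bead {p : ℕ} {γ : YoungDiagram} (hp : 1 ≤ p) :
    IsCore p γ ↔ ∀ x, Bead γ x → Bead γ (x - p) := by
  constructor
  · rintro h x ⟨r, hr⟩
    by_contra hb
    obtain ⟨c, hc⟩ := not_bead_iff.1 hb
    have h₁ : (r, c) ∈ γ ↔ c < γ.rowLen r := YoungDiagram.mem_iff_lt_rowLen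
    have h₂ : (r, c) ∈ γ ↔ r < γ.colLen c := YoungDiagram.mem_iff_lt_colLen
    have hm : (r, c) ∈ γ := by
      by_contra hm
      have := mt h₁.2 hm; have := mt h₂.2 hm; omega
    have := h₁.1 hm
    have := h₂.1 hm
    exact h _ hm (by simp only [hookLen]; omega)
  · rintro h ⟨r, c⟩ hm hh
    have h₁ := YoungDiagram.mem_iff_lt_rowLen.1 hm
    have h₂ := YoungDiagram.mem_iff_lt_colLen.1 hm
    simp only [hookLen] at hh
    exact not_bead_iff.2 ⟨c, by omega⟩ (h _ ⟨r, rfl⟩)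

theorem bead_sub_mul {p : ℕ} {γ : YoungDiagram} (h : ∀ x, Bead γ x → Bead γ (x - p))
    {x : ℤ} (hx : Bead γ x) (m : ℕ) : Bead γ (x - p * m) := by
  induction m with
  | zero => simpa using hx
  | succ m ih => convert h _ ih using 1; push_cast; ring

theorem bead_of_cast_eq {k : ℕ} {γ : YoungDiagram}
    (h : ∀ x, Bead γ x → Bead γ (x - (k + 1 : ℕ))) {x y : ℤ} (hx : Bead γ x)
    (hxy : (y : ZMod (k + 1)) = x) (hle : y ≤ x) : Bead γ y := by
  obtain ⟨m, hm⟩ := (ZMod.intCast_eq_intCast_iff_dvd_sub y x (k + 1)).1 hxy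
  have hm0 : 0 ≤ m := by
    by_contra! hneg
    have : ((k + 1 : ℕ) : ℤ) * m < 0 := mul_neg_of_pos_of_neg (by positivity) hneg
    omega
  lift m to ℕ using hm0
  have := bead_sub_mul h hx m
  rwa [← hm, sub_sub_cancel] at this

theorem le_sub_of_cast_eq {k : ℕ} {x y : ℤ} (hxy : (x : ZMod (k + 1)) = y) (hlt : x < y) :
    x ≤ y - (k + 1 : ℕ) := by
  have := Int.le_of_dvd (by omega) ((ZMod.intCast_eq_intCast_iff_dvd_sub x y (k + 1)).1 hxy)
  omega

theorem StripContent.bead_or_stripContent {β γ : YoungDiagram} {x : ℤ}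
    (hx : StripContent β γ (x - 1)) : Bead γ x ∨ StripContent β γ x := by
  obtain ⟨r, h₁, h₂⟩ := hx
  by_cases he : x = (γ.rowLen r : ℤ) - r
  · exact Or.inl ⟨r, he⟩
  · exact Or.inr ⟨r, by omega, by omega⟩

namespace IsHorizontalStrip

variable {β γ : YoungDiagram}

theorem rowLen_le (h : IsHorizontalStrip β γ) (r : ℕ) : β.rowLen r ≤ γ.rowLen r := by
  by_contra! hlt
  have : (r, γ.rowLen r) ∈ γ := h.1 (YoungDiagram.mem_iff_lt_rowLen.2 hlt)
  exact lt_irrefl _ (YoungDiagram.mem_iff_lt_rowLen.1 this)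

theorem rowLen_le_of_lt (h : IsHorizontalStrip β γ) {s r : ℕ} (hsr : s < r) :
    γ.rowLen r ≤ β.rowLen s := by
  by_contra! hlt
  have h₁ : (r, β.rowLen s) ∈ γ := YoungDiagram.mem_iff_lt_rowLen.2 hlt
  have h₂ : (s, β.rowLen s) ∈ γ := γ.up_left_mem hsr.le le_rfl h₁
  have h₃ : (s, β.rowLen s) ∉ β := by simp [YoungDiagram.mem_iff_lt_rowLen]
  have h₄ : (r, β.rowLen s) ∉ β := fun hm => h₃ (β.up_left_mem hsr.le le_rfl hm)
  have := congrArg Prod.fst (h.2 _ _ h₁ h₄ h₂ h₃ rfl)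
  simp only at this
  omega

theorem not_bead_of_stripContent (h : IsHorizontalStrip β γ) {x : ℤ}
    (hx : StripContent β γ x) : ¬ Bead γ x := by
  rintro ⟨s, hs⟩
  obtain ⟨r, h₁, h₂⟩ := hx
  rcases lt_trichotomy s r with hsr | rfl | hsr
  · have := h.rowLen_le_of_lt hsr; have := h.rowLen_le s; omega
  · omega
  · have := h.rowLen_le_of_lt hsr; omega

theorem not_stripContent_of_bead (h : IsHorizontalStrip β γ) {x : ℤ}
    (hx : Bead β x) : ¬ StripContent β γ (x - 1) := by
  rintro ⟨r, h₁, h₂⟩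
  obtain ⟨s, hs⟩ := hx
  rcases lt_trichotomy s r with hsr | rfl | hsr
  · have := h.rowLen_le_of_lt hsr; omega
  · omega
  · have := h.rowLen_le_of_lt hsr; have := h.rowLen_le s; omega

theorem bead_iff (h : IsHorizontalStrip β γ) {x : ℤ} :
    Bead β x ↔ ¬ StripContent β γ (x - 1) ∧ (StripContent β γ x ∨ Bead γ x) := by
  constructor
  · intro hx
    refine ⟨h.not_stripContent_of_bead hx, ?_⟩
    obtain ⟨r, hr⟩ := hx
    have := h.rowLen_le r
    by_cases he : β.rowLen r = γ.rowLen r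
    · exact Or.inr ⟨r, by omega⟩
    · exact Or.inl ⟨r, by omega, by omega⟩
  · rintro ⟨h₁, ⟨r, h₂⟩ | ⟨r, h₂⟩⟩ <;> refine ⟨r, ?_⟩ <;> by_contra hne <;>
      refine h₁ ⟨r, ?_⟩
    · omega
    · have := h.rowLen_le r; omega

end IsHorizontalStrip

/-- The indicator of the bead set. -/
noncomputable def beadInd (γ : YoungDiagram) (x : ℤ) : ℤ := if Bead γ x then 1 else 0

/-- The indicator of the set of contents of a strip. -/
noncomputable def stripInd (β γ : YoungDiagram) (x : ℤ) : ℤ := if StripContent β γ x then 1 else 0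

theorem pSize_eq_sum (k : ℕ) (γ : YoungDiagram) {L : ℤ} (h₁ : (γ.colLen 0 : ℤ) ≤ L)
    (h₂ : (γ.rowLen 0 : ℤ) ≤ L) :
    (pSize k γ : ℤ) = ∑ x ∈ Finset.Icc (-L) L, ∑ j ∈ Finset.Icc 1 (k : ℤ),
      (1 - beadInd γ x) * beadInd γ (x + j) := by
  have hterm : ∀ x j : ℤ, (1 - beadInd γ x) * beadInd γ (x + j) =
      if ¬ Bead γ x ∧ Bead γ (x + j) then 1 else 0 := by
    intro x j
    simp only [beadInd]
    split_ifs <;> simp_all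
  simp only [hterm]
  rw [← Finset.sum_product', Finset.sum_boole, pSize]
  norm_cast
  refine Finset.card_bij
    (fun c _ => ((c.2 : ℤ) + 1 - γ.colLen c.2, (hookLen γ c.1 c.2 : ℤ))) ?_ ?_ ?_
  · rintro ⟨r, c⟩ hc
    simp only [Finset.mem_filter, YoungDiagram.mem_cells] at hc
    have hr := YoungDiagram.mem_iff_lt_rowLen.1 hc.1
    have hl := YoungDiagram.mem_iff_lt_colLen.1 hc.1
    have := γ.colLen_anti 0 c (Nat.zero_le _)
    have := γ.rowLen_anti 0 r (Nat.zero_le _)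
    have hh := hc.2
    simp only [hookLen] at hh
    simp only [Finset.mem_filter, Finset.mem_product, Finset.mem_Icc, hookLen]
    refine ⟨⟨⟨by omega, by omega⟩, by omega, by omega⟩, not_bead_iff.2 ⟨c, rfl⟩, r, by omega⟩
  · rintro ⟨r, c⟩ hc ⟨r', c'⟩ hc' he
    simp only [Finset.mem_filter, YoungDiagram.mem_cells] at hc hc'
    have hr := YoungDiagram.mem_iff_lt_rowLen.1 hc.1
    have hl := YoungDiagram.mem_iff_lt_colLen.1 hc.1
    have hr' := YoungDiagram.mem_iff_lt_rowLen.1 hc'.1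
    have hl' := YoungDiagram.mem_iff_lt_colLen.1 hc'.1
    simp only [Prod.mk.injEq, hookLen] at he
    obtain ⟨e₁, e₂⟩ := he
    have ec : c = c' := by
      rcases le_total c c' with h | h
      · have := γ.colLen_anti _ _ h; omega
      · have := γ.colLen_anti _ _ h; omega
    subst ec
    have er : r = r' := by
      rcases le_total r r' with h | h
      · have := γ.rowLen_anti _ _ h; omega
      · have := γ.rowLen_anti _ _ h; omega
    rw [er]
  · rintro ⟨x, j⟩ hx
    simp only [Finset.mem_filter, Finset.mem_product, Finset.mem_Icc] at hx
    obtain ⟨⟨-, hj⟩, hg, r, hr⟩ := hx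
    obtain ⟨c, hc⟩ := not_bead_iff.1 hg
    have e₁ : (r, c) ∈ γ ↔ c < γ.rowLen r := YoungDiagram.mem_iff_lt_rowLen
    have e₂ : (r, c) ∈ γ ↔ r < γ.colLen c := YoungDiagram.mem_iff_lt_colLen
    have hm : (r, c) ∈ γ := by
      by_contra hm
      have := mt e₁.2 hm; have := mt e₂.2 hm; omega
    have := e₁.1 hm
    have := e₂.1 hm
    refine ⟨(r, c), ?_, ?_⟩
    · rw [Finset.mem_filter, YoungDiagram.mem_cells]
      exact ⟨hm, by simp only [hookLen]; omega⟩
    · simp only [Prod.mk.injEq, hookLen]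
      omega

theorem sum_Icc_shift {f : ℤ → ℤ} {M L s : ℤ} (hf : ∀ x, f x ≠ 0 → -M ≤ x ∧ x ≤ M)
    (h₁ : M + s ≤ L) (h₂ : M - s ≤ L) :
    ∑ x ∈ Finset.Icc (-L) L, f (x + s) = ∑ x ∈ Finset.Icc (-L) L, f x := by
  rw [← finsum_eq_sum_of_support_subset, ← finsum_eq_sum_of_support_subset]
  · exact finsum_comp_equiv (Equiv.addRight s)
  · intro x hx
    have := hf _ hx
    simp only [Finset.coe_Icc, Set.mem_Icc]
    omega
  · intro x hx
    have := hf _ hx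
    simp only [Finset.coe_Icc, Set.mem_Icc]
    omega

theorem sum_Icc_telescope (f : ℤ → ℤ) (a : ℤ) (k : ℕ) :
    ∑ j ∈ Finset.Icc 1 (k : ℤ), (f (a + j) - f (a + j - 1)) = f (a + k) - f a := by
  induction k with
  | zero => simp
  | succ k ih =>
    have : Finset.Icc 1 ((k + 1 : ℕ) : ℤ) = insert ((k : ℤ) + 1) (Finset.Icc 1 (k : ℤ)) := by
      ext z; simp only [Finset.mem_Icc, Finset.mem_insert]; omega
    rw [this, Finset.sum_insert (by simp), ih]
    push_cast
    have : a + ((k : ℤ) + 1) - 1 = a + k := by ring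
    rw [this, ← add_assoc]
    ring

namespace IsHorizontalStrip

variable {β γ : YoungDiagram}

theorem stripInd_sub (h : IsHorizontalStrip β γ) (x : ℤ) :
    stripInd β γ x - stripInd β γ (x - 1) = beadInd β x - beadInd γ x := by
  have h₁ := h.bead_iff (x := x)
  have h₂ := h.not_bead_of_stripContent (x := x)
  have h₃ := StripContent.bead_or_stripContent (β := β) (γ := γ) (x := x)
  simp only [stripInd, beadInd]
  split_ifs <;> first | rfl | tauto

theorem bead_sum_eq (h : IsHorizontalStrip β γ) {k : ℕ}
    (hβ : ∀ x, Bead β x → Bead β (x - (k + 1 : ℕ)))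
    (hγ : ∀ x, Bead γ x → Bead γ (x - (k + 1 : ℕ))) {M L : ℤ}
    (hM : ∀ x, StripContent β γ x → -M ≤ x ∧ x ≤ M) (hL : M + 2 * k + 2 ≤ L) :
    ∑ x ∈ Finset.Icc (-L) L, ∑ j ∈ Finset.Icc 1 (k : ℤ),
        (1 - beadInd γ x) * beadInd γ (x + j) =
      (∑ x ∈ Finset.Icc (-L) L, ∑ j ∈ Finset.Icc 1 (k : ℤ),
        (1 - beadInd β x) * beadInd β (x + j)) +
      ∑ x ∈ Finset.Icc (-L) L, stripInd β γ x * beadInd γ (x - (k + 1 : ℕ)) := by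
  set p := beadInd γ with hp
  set q := beadInd β with hq
  set d := stripInd β γ with hd
  have hdM : ∀ x, d x ≠ 0 → -M ≤ x ∧ x ≤ M := by
    intro x hx
    apply hM
    by_contra hn
    exact hx (by simp [hd, stripInd, hn])
  have hdq : ∀ x, d x - d (x - 1) = q x - p x := h.stripInd_sub
  have hpd : ∀ x, p x * d x = 0 := by
    intro x
    have := h.not_bead_of_stripContent (x := x)
    simp only [hp, hd, stripInd, beadInd]
    split_ifs <;> simp_all
  have hqd : ∀ x, q x * d (x - 1) = 0 := by
    intro x
    have := h.not_stripContent_of_bead (x := x)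
    simp only [hq, hd, stripInd, beadInd]
    split_ifs <;> simp_all
  have hpn : ∀ x, p (x - (k + 1 : ℕ)) * p x = p x := by
    intro x
    have := hγ x
    simp only [hp, beadInd]
    split_ifs <;> simp_all
  have hqn : ∀ x, q x * (1 - p (x - (k + 1 : ℕ)) - d (x - (k + 1 : ℕ))) = 0 := by
    intro x
    have h₁ := hβ x
    have h₂ := h.bead_iff (x := x - (k + 1 : ℕ))
    have h₃ := h.not_bead_of_stripContent (x := x - (k + 1 : ℕ))
    simp only [hq, hp, hd, stripInd, beadInd]
    split_ifs <;> first | rfl | tauto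
  set W := Finset.Icc (-L) L with hW
  have hinner₁ : ∀ x, ∑ j ∈ Finset.Icc 1 (k : ℤ), (1 - p x) * (p (x + j) - q (x + j)) =
      (1 - p x) * (d x - d (x + k)) := by
    intro x
    rw [← Finset.mul_sum, ← neg_sub (d (x + k)), ← sum_Icc_telescope, ← Finset.sum_neg_distrib]
    congr 1
    refine Finset.sum_congr rfl fun j _ => ?_
    rw [hdq]; ring
  have hinner₂ : ∑ x ∈ W, ∑ j ∈ Finset.Icc 1 (k : ℤ), (q x - p x) * q (x + j) =
      ∑ x ∈ W, q x * (d (x - 1) - d (x - 1 - k)) := by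
    have hswap : ∀ j ∈ Finset.Icc 1 (k : ℤ), ∑ x ∈ W, (q x - p x) * q (x + j) =
        ∑ x ∈ W, (d (x - j) - d (x - j - 1)) * q x := by
      intro j hj
      rw [Finset.mem_Icc] at hj
      rw [← sum_Icc_shift (f := fun x => (d (x - j) - d (x - j - 1)) * q x)
        (M := M + 1 + j) (s := j) (L := L) _ (by omega) (by omega)]
      · refine Finset.sum_congr rfl fun x _ => ?_
        simp only [add_sub_cancel_right, hdq]
      · intro x hx
        by_cases h₀ : d (x - j) = 0
        · have := hdM (x - j - 1) (fun h₁ => hx (by simp [h₀, h₁]))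
          omega
        · have := hdM _ h₀
          omega
    rw [Finset.sum_comm, Finset.sum_congr rfl hswap, Finset.sum_comm]
    refine Finset.sum_congr rfl fun x _ => ?_
    rw [← Finset.sum_mul, mul_comm]
    congr 1
    have := sum_Icc_telescope (fun y => -d (-y)) (1 - x) k
    rw [show d (x - 1) - d (x - 1 - k) = -d (-(1 - x + k)) - -d (-(1 - x)) by ring_nf, ← this]
    refine Finset.sum_congr rfl fun j _ => ?_
    ring_nf
  have hshift₁ : ∑ x ∈ W, (1 - p x) * d (x + k) = ∑ x ∈ W, (1 - p (x - k)) * d x := by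
    rw [← sum_Icc_shift (f := fun x => (1 - p (x - k)) * d x) (M := M) (s := k) (L := L)
      (fun x hx => hdM x (right_ne_zero_of_mul hx)) (by omega) (by omega)]
    simp only [add_sub_cancel_right, hW]
  have hshift₂ : ∑ x ∈ W, p (x - k) * d x = ∑ x ∈ W, p (x - (k + 1 : ℕ)) * d (x - 1) := by
    rw [← sum_Icc_shift (f := fun x => p (x - (k + 1 : ℕ)) * d (x - 1)) (M := M + 1) (s := 1)
      (L := L) _ (by omega) (by omega)]
    · refine Finset.sum_congr rfl fun x _ => ?_
      push_cast
      ring_nf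
    · intro x hx
      have := hdM _ (right_ne_zero_of_mul hx)
      omega
  have hshift₃ : ∑ x ∈ W, d (x - 1) = ∑ x ∈ W, d x := by
    rw [← sum_Icc_shift (f := fun x => d (x - 1)) (M := M + 1) (s := 1) (L := L) _
      (by omega) (by omega)]
    · simp only [add_sub_cancel_right, hW]
    · intro x hx
      have := hdM _ hx
      omega
  have hsplit : ∑ x ∈ W, ∑ j ∈ Finset.Icc 1 (k : ℤ), (1 - p x) * p (x + j) -
      ∑ x ∈ W, ∑ j ∈ Finset.Icc 1 (k : ℤ), (1 - q x) * q (x + j) =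
      ∑ x ∈ W, (1 - p x) * (d x - d (x + k)) +
        ∑ x ∈ W, q x * (d (x - 1) - d (x - 1 - k)) := by
    rw [← hinner₂, ← Finset.sum_congr rfl fun x _ => hinner₁ x]
    simp only [← Finset.sum_add_distrib, ← Finset.sum_sub_distrib]
    refine Finset.sum_congr rfl fun x _ => Finset.sum_congr rfl fun j _ => ?_
    ring
  have hfirst : ∑ x ∈ W, (1 - p x) * (d x - d (x + k)) =
      ∑ x ∈ W, p (x - (k + 1 : ℕ)) * d (x - 1) := by
    rw [← hshift₂]
    have : ∀ x, (1 - p x) * (d x - d (x + k)) = d x - (1 - p x) * d (x + k) := fun x => by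
      linear_combination -hpd x
    simp only [this]
    rw [Finset.sum_sub_distrib, hshift₁, ← Finset.sum_sub_distrib]
    refine Finset.sum_congr rfl fun x _ => ?_
    ring
  have hpoint : ∀ x, p (x - (k + 1 : ℕ)) * d (x - 1) + q x * (d (x - 1) - d (x - 1 - k)) -
      d x * p (x - (k + 1 : ℕ)) = d (x - 1) - d x := by
    intro x
    rw [show x - 1 - (k : ℤ) = x - (k + 1 : ℕ) by push_cast; ring]
    linear_combination hqd x + (1 - p (x - (k + 1 : ℕ))) * hdq x + hpn x + hqn x
  rw [← sub_eq_iff_eq_add', hsplit, hfirst, ← Finset.sum_add_distrib, ← sub_eq_zero,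
    ← Finset.sum_sub_distrib, Finset.sum_congr rfl fun x _ => hpoint x, Finset.sum_sub_distrib,
    hshift₃, sub_self]

end IsHorizontalStrip

/-- The contents of the cells of `γ/β` lying on the first non-bead position of their residue
class in `γ`. -/
noncomputable def leadingContents (k : ℕ) (β γ : YoungDiagram) : Finset ℤ :=
  ((γ.cells \ β.cells).image content).filter fun x => Bead γ (x - (k + 1 : ℕ))

theorem mem_leadingContents {β γ : YoungDiagram} {k : ℕ} {x : ℤ} :
    x ∈ leadingContents k β γ ↔ StripContent β γ x ∧ Bead γ (x - (k + 1 : ℕ)) := by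
  simp only [leadingContents, Finset.mem_filter, Finset.mem_image, Finset.mem_sdiff,
    YoungDiagram.mem_cells, stripContent_iff, and_assoc]

namespace IsHorizontalStrip

variable {β γ : YoungDiagram}

theorem pSize_eq (h : IsHorizontalStrip β γ) {k : ℕ} (hβ : IsCore (k + 1) β)
    (hγ : IsCore (k + 1) γ) : pSize k γ = pSize k β + (leadingContents k β γ).card := by
  rw [isCore_iff_bead (by omega)] at hβ hγ
  set M : ℤ := γ.rowLen 0 + γ.colLen 0
  have hcol : β.colLen 0 ≤ γ.colLen 0 := by
    by_contra! hlt
    have : (γ.colLen 0, 0) ∈ γ := h.1 (YoungDiagram.mem_iff_lt_colLen.2 hlt)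
    exact lt_irrefl _ (YoungDiagram.mem_iff_lt_colLen.1 this)
  have hrow := h.rowLen_le 0
  have hM : ∀ x, StripContent β γ x → -M ≤ x ∧ x ≤ M := by
    intro x hx
    obtain ⟨⟨r, c⟩, hc, -, rfl⟩ := stripContent_iff.1 hx
    have h₁ := YoungDiagram.mem_iff_lt_rowLen.1 hc
    have h₂ := YoungDiagram.mem_iff_lt_colLen.1 hc
    have := γ.colLen_anti 0 c (Nat.zero_le _)
    have := γ.rowLen_anti 0 r (Nat.zero_le _)
    simp only [content]
    omega
  have key := h.bead_sum_eq hβ hγ hM le_rfl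
  rw [← pSize_eq_sum k γ (by omega) (by omega), ← pSize_eq_sum k β (by omega) (by omega)] at key
  have hcard : ∑ x ∈ Finset.Icc (-(M + 2 * k + 2)) (M + 2 * k + 2),
      stripInd β γ x * beadInd γ (x - (k + 1 : ℕ)) = (leadingContents k β γ).card := by
    have hterm : ∀ x, stripInd β γ x * beadInd γ (x - (k + 1 : ℕ)) =
        if x ∈ leadingContents k β γ then 1 else 0 := by
      intro x
      simp only [stripInd, beadInd, mem_leadingContents]
      split_ifs <;> simp_all
    simp only [hterm]
    rw [Finset.sum_boole]
    congr 2
    ext x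
    simp only [Finset.mem_filter, Finset.mem_Icc, and_iff_right_iff_imp]
    intro hx
    have := hM x (mem_leadingContents.1 hx).1
    omega
  rw [hcard] at key
  exact_mod_cast key

theorem injOn_leadingContents (h : IsHorizontalStrip β γ) {k : ℕ} (hγ : IsCore (k + 1) γ) :
    Set.InjOn (fun x : ℤ => (x : ZMod (k + 1))) (leadingContents k β γ) := by
  rw [isCore_iff_bead (by omega)] at hγ
  have aux : ∀ x y : ℤ, x ∈ leadingContents k β γ → y ∈ leadingContents k β γ →
      (x : ZMod (k + 1)) = y → ¬ x < y := by
    intro x y hx hy hxy hlt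
    refine h.not_bead_of_stripContent (mem_leadingContents.1 hx).1
      (bead_of_cast_eq hγ (mem_leadingContents.1 hy).2 ?_ (le_sub_of_cast_eq hxy hlt))
    rw [hxy]
    have : (((k + 1 : ℕ) : ℤ) : ZMod (k + 1)) = 0 := by
      rw [Int.cast_natCast, ZMod.natCast_self]
    rw [Int.cast_sub, this, sub_zero]
  intro x hx y hy hxy
  exact le_antisymm (not_lt.1 (aux y x hy hx hxy.symm)) (not_lt.1 (aux x y hx hy hxy))

end IsHorizontalStrip

theorem IsAffineStrip.exists_mem_leadingContents {k r : ℕ} {β γ : YoungDiagram}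
    (h : IsAffineStrip k r β γ) {i : ZMod (k + 1)} (hi : i ∈ resSet k β γ) :
    ∃ x ∈ leadingContents k β γ, (x : ZMod (k + 1)) = i := by
  obtain ⟨-, hβ, hγ, hs, hp, hr⟩ := h
  have hcard : (leadingContents k β γ).card = r := by
    have := hs.pSize_eq hβ hγ
    omega
  have hsub : (leadingContents k β γ).image (fun x : ℤ => (x : ZMod (k + 1))) ⊆ resSet k β γ := by
    intro a ha
    obtain ⟨x, hx, rfl⟩ := Finset.mem_image.1 ha
    obtain ⟨c, hc, hc', rfl⟩ := stripContent_iff.1 (mem_leadingContents.1 hx).1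
    exact Finset.mem_image.2 ⟨c, by simp [hc, hc'], residue_eq_content k c⟩
  have heq := Finset.eq_of_subset_of_card_le hsub (by
    rw [Finset.card_image_of_injOn (hs.injOn_leadingContents hγ), hcard, hr])
  rw [← heq] at hi
  exact Finset.mem_image.1 hi

theorem Removable.bead {γ : YoungDiagram} {c : ℕ × ℕ} (h : Removable γ c) :
    Bead γ (content c + 1) := by
  obtain ⟨h₁, -, h₃⟩ := h
  rw [YoungDiagram.mem_iff_lt_rowLen] at h₁ h₃
  exact ⟨c.1, by simp only [content]; omega⟩

theorem Removable.not_bead {γ : YoungDiagram} {c : ℕ × ℕ} (h : Removable γ c) :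
    ¬ Bead γ (content c) := by
  obtain ⟨h₁, h₂, -⟩ := h
  rw [YoungDiagram.mem_iff_lt_colLen] at h₁ h₂
  exact not_bead_iff.2 ⟨c.2, by simp only [content]; omega⟩

theorem exists_removable_of_bead {γ : YoungDiagram} {x : ℤ} (h₁ : ¬ Bead γ x)
    (h₂ : Bead γ (x + 1)) : ∃ c, Removable γ c ∧ content c = x := by
  obtain ⟨r, hr⟩ := h₂
  have hnext : (γ.rowLen (r + 1) : ℤ) - (r + 1 : ℕ) ≠ x := fun e => h₁ ⟨r + 1, e.symm⟩
  have := γ.rowLen_anti r (r + 1) (Nat.le_succ r)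
  refine ⟨(r, γ.rowLen r - 1), ⟨?_, ?_, ?_⟩, ?_⟩
  · rw [YoungDiagram.mem_iff_lt_rowLen]; omega
  · rw [YoungDiagram.mem_iff_lt_rowLen]; simp only; omega
  · rw [YoungDiagram.mem_iff_lt_rowLen]; simp only; omega
  · simp only [content]; omega

/-- `γhat` arises from `γ` by deleting all removable `i`-corners. -/
def IsCornerDeletion (k : ℕ) (i : ZMod (k + 1)) (γ γhat : YoungDiagram) : Prop :=
  γhat.cells = γ.cells.filter fun d => ¬ (Removable γ d ∧ residue k d = i)

namespace IsCornerDeletion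

variable {k : ℕ} {i : ZMod (k + 1)} {γ γhat : YoungDiagram}

theorem mem_iff (h : IsCornerDeletion k i γ γhat) {d : ℕ × ℕ} :
    d ∈ γhat ↔ d ∈ γ ∧ ¬ (Removable γ d ∧ residue k d = i) := by
  rw [← YoungDiagram.mem_cells, h, Finset.mem_filter, YoungDiagram.mem_cells]

theorem mem_and_not_mem_iff (h : IsCornerDeletion k i γ γhat) {d : ℕ × ℕ} :
    d ∈ γ ∧ d ∉ γhat ↔ Removable γ d ∧ residue k d = i := by
  rw [h.mem_iff]
  have : Removable γ d → d ∈ γ := fun h => h.1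
  tauto

theorem isHorizontalStrip (h : IsCornerDeletion k i γ γhat) : IsHorizontalStrip γhat γ := by
  refine ⟨fun d hd => (h.mem_iff.1 hd).1, ?_⟩
  rintro ⟨a, c⟩ ⟨b, c'⟩ ha ha' hb hb' rfl
  obtain ⟨⟨h₁, h₂, -⟩, -⟩ := h.mem_and_not_mem_iff.1 ⟨ha, ha'⟩
  obtain ⟨⟨h₃, h₄, -⟩, -⟩ := h.mem_and_not_mem_iff.1 ⟨hb, hb'⟩
  rw [YoungDiagram.mem_iff_lt_colLen] at h₁ h₂ h₃ h₄
  simp only [Prod.mk.injEq, and_true]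
  simp only at h₁ h₂ h₃ h₄
  omega

theorem stripContent_iff (h : IsCornerDeletion k i γ γhat) {x : ℤ} :
    StripContent γhat γ x ↔ (x : ZMod (k + 1)) = i ∧ ¬ Bead γ x ∧ Bead γ (x + 1) := by
  rw [AffineKTheory.stripContent_iff]
  constructor
  · rintro ⟨c, hc, hc', rfl⟩
    obtain ⟨h₁, h₂⟩ := h.mem_and_not_mem_iff.1 ⟨hc, hc'⟩
    exact ⟨by rw [← residue_eq_content, h₂], h₁.not_bead, h₁.bead⟩
  · rintro ⟨hi, h₁, h₂⟩
    obtain ⟨c, hc, rfl⟩ := exists_removable_of_bead h₁ h₂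
    obtain ⟨h₃, h₄⟩ := h.mem_and_not_mem_iff.2 ⟨hc, by rw [residue_eq_content, hi]⟩
    exact ⟨c, h₃, h₄, rfl⟩

theorem isCore (h : IsCornerDeletion k i γ γhat) (hk : 1 ≤ k) (hγ : IsCore (k + 1) γ) :
    IsCore (k + 1) γhat := by
  rw [isCore_iff_bead (by omega)] at hγ ⊢
  intro x hx
  have hn : (((k + 1 : ℕ) : ℤ) : ZMod (k + 1)) = 0 := by
    rw [Int.cast_natCast, ZMod.natCast_self]
  have : Fact (1 < k + 1) := ⟨by omega⟩
  have hne : ¬ ((x - 1 : ℤ) : ZMod (k + 1)) = (x : ℤ) := by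
    simp
  rw [h.isHorizontalStrip.bead_iff, h.stripContent_iff, h.stripContent_iff] at hx ⊢
  have e₁ : x - (k + 1 : ℕ) - 1 = x - 1 - (k + 1 : ℕ) := by ring
  have e₂ : x - (k + 1 : ℕ) + 1 = x + 1 - (k + 1 : ℕ) := by ring
  have c₁ : ((x - (k + 1 : ℕ) : ℤ) : ZMod (k + 1)) = x := by
    rw [Int.cast_sub, hn, sub_zero]
  have c₂ : ((x - 1 - (k + 1 : ℕ) : ℤ) : ZMod (k + 1)) = (x - 1 : ℤ) := by
    rw [Int.cast_sub, hn, sub_zero]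
  rw [sub_add_cancel] at hx ⊢
  rw [e₁, e₂, c₁, c₂]
  have m₁ := hγ x
  have m₂ := hγ (x - 1)
  have m₃ := hγ (x + 1)
  grind

end IsCornerDeletion

/-- If `γ/β` is an affine `r`-strip with `r ≥ 1` and `i` is the residue of its
rightmost cell (the cell of `γ/β` in the rightmost occupied column), then `γ̂/β` is an affine
`(r-1)`-strip, where `γ̂` is obtained from `γ` by deleting all removable `i`-corners of `γ`. -/
theorem affineStrip_delete_rightmost_residue
    (k : ℕ) (hk : 1 ≤ k) (r : ℕ) (hr : 1 ≤ r) (β γ : YoungDiagram)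
    (h : IsAffineStrip k r β γ) (i : ZMod (k + 1)) (c : ℕ × ℕ)
    (hcγ : c ∈ γ) (hcβ : c ∉ β) (hres : residue k c = i)
    (hrightmost : ∀ d : ℕ × ℕ, d ∈ γ → d ∉ β → d.2 ≤ c.2)
    (γhat : YoungDiagram)
    (hγhat : γhat.cells = γ.cells.filter fun d => ¬ (Removable γ d ∧ residue k d = i)) :
    IsAffineStrip k (r - 1) β γhat := by
  have hdel : IsCornerDeletion k i γ γhat := hγhat
  obtain ⟨hrk, hβ, hγ, hs, hp, hcard⟩ := id h
  have hβb := (isCore_iff_bead (by omega)).1 hβ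
  have hγb := (isCore_iff_bead (by omega)).1 hγ
  have hi : i ∈ resSet k β γ := Finset.mem_image.2 ⟨c, by simp [hcγ, hcβ], hres⟩
  obtain ⟨x, hx, hxi⟩ := h.exists_mem_leadingContents hi
  obtain ⟨hxs, hxb⟩ := mem_leadingContents.1 hx
  have hup : ∀ d : ℕ × ℕ, d ∈ γ → d ∉ β → (d.1 + 1, d.2) ∉ γ := by
    intro d hd hd' hu
    have hu' : (d.1 + 1, d.2) ∉ β := fun hu' => hd' (β.up_left_mem (Nat.le_succ _) le_rfl hu')
    have := congrArg Prod.fst (hs.2 _ _ hd hd' hu hu' rfl)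
    simp at this
  have hright : ∀ d : ℕ × ℕ, d ∉ β → (d.1, d.2 + 1) ∉ β :=
    fun d hd hu => hd (β.up_left_mem le_rfl (Nat.le_succ _) hu)
  have hcrem : Removable γ c := by
    refine ⟨hcγ, hup c hcγ hcβ, fun hu => ?_⟩
    have := hrightmost _ hu (hright c hcβ)
    simp at this
  have hrem : ∀ d : ℕ × ℕ, d ∈ γ → d ∉ β → residue k d = i → Removable γ d := by
    intro d hd hd' hdi
    refine ⟨hd, hup d hd hd', fun hu => ?_⟩
    have hle : content d ≤ content c := by
      have h₁ := hrightmost d hd hd'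
      rcases lt_or_ge d.1 c.1 with hlt | hge
      · have := hs.rowLen_le_of_lt hlt
        rw [YoungDiagram.mem_iff_lt_rowLen] at hcγ hd'
        omega
      · simp only [content]; omega
    have hb : Bead γ (content d + 1) := by
      refine bead_of_cast_eq hγb hcrem.bead ?_ (by omega)
      rw [Int.cast_add, Int.cast_add, ← residue_eq_content, ← residue_eq_content, hdi, hres]
    refine hs.not_bead_of_stripContent (stripContent_iff.2 ⟨_, hu, hright d hd', ?_⟩) hb
    simp only [content]
    push_cast
    ring
  have hle : β ≤ γhat := by
    intro d hd
    refine hdel.mem_iff.2 ⟨hs.1 hd, fun ⟨hdr, hdi⟩ => ?_⟩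
    have hcast : (x : ZMod (k + 1)) = content d := by rw [← residue_eq_content, hdi, hxi]
    rcases le_or_gt x (content d) with hxd | hxd
    · have hdβ : Removable β d :=
        ⟨hd, fun hu => hdr.2.1 (hs.1 hu), fun hu => hdr.2.2 (hs.1 hu)⟩
      have hb : Bead β (x + 1) := by
        refine bead_of_cast_eq hβb hdβ.bead ?_ (by omega)
        rw [Int.cast_add, Int.cast_add, hcast]
      refine hs.not_stripContent_of_bead hb ?_
      rwa [add_sub_cancel_right]
    · refine hdr.not_bead (bead_of_cast_eq hγb hxb ?_ (le_sub_of_cast_eq hcast.symm hxd))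
      have hn : (((k + 1 : ℕ) : ℤ) : ZMod (k + 1)) = 0 := by
        rw [Int.cast_natCast, ZMod.natCast_self]
      rw [Int.cast_sub, hn, sub_zero, hcast]
  have hcore := hdel.isCore hk hγ
  have hlead : leadingContents k γhat γ = {x} := by
    have hxmem : x ∈ leadingContents k γhat γ := by
      obtain ⟨d, hd, hd', rfl⟩ := stripContent_iff.1 hxs
      rw [← residue_eq_content] at hxi
      obtain ⟨h₁, h₂⟩ := hdel.mem_and_not_mem_iff.2 ⟨hrem d hd hd' hxi, hxi⟩
      exact mem_leadingContents.2 ⟨stripContent_iff.2 ⟨d, h₁, h₂, rfl⟩, hxb⟩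
    refine Finset.eq_singleton_iff_unique_mem.2 ⟨hxmem, fun y hy => ?_⟩
    refine hdel.isHorizontalStrip.injOn_leadingContents hγ hy hxmem ?_
    exact (hdel.stripContent_iff.1 (mem_leadingContents.1 hy).1).1.trans hxi.symm
  have hsize := hdel.isHorizontalStrip.pSize_eq hcore hγ
  rw [hlead, Finset.card_singleton] at hsize
  have hresSet : resSet k β γhat = (resSet k β γ).erase i := by
    ext a
    simp only [resSet, Finset.mem_erase, Finset.mem_image, Finset.mem_sdiff,
      YoungDiagram.mem_cells, hdel.mem_iff]
    constructor
    · rintro ⟨d, ⟨⟨hd, hn⟩, hd'⟩, rfl⟩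
      exact ⟨fun e => hn ⟨hrem d hd hd' e, e⟩, d, ⟨hd, hd'⟩, rfl⟩
    · rintro ⟨hne, d, ⟨hd, hd'⟩, rfl⟩
      exact ⟨d, ⟨⟨hd, fun e => hne e.2⟩, hd'⟩, rfl⟩
  refine ⟨by omega, hβ, hcore, ⟨hle, ?_⟩, by omega, ?_⟩
  · intro d e hd hd' he he'
    exact hs.2 d e (hdel.mem_iff.1 hd).1 hd' (hdel.mem_iff.1 he).1 he'
  · rw [hresSet, Finset.card_erase_of_mem hi, hcard]

end AffineKTheory
end
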